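/- arXiv:1504.05151 — 2 statements merged into one kernel-verified Lean document; each statement's English description precedes it below -/
import Mathlib

section
/- Let n ≥ 1, s ≥ n + 3, d ≥ 2 be integers and let d ≥ m_1 ≥ m_2 ≥ ⋯ ≥ m_s ≥ 1. Let s(d) = #{i : m_i = d} and b = min{n − s(d), s − n − 2}. Assume Σ_{i=1}^s m_i ≤ nd + b and d ≥ m_1 + m_2 − 1. Then there exists a nonempty Zariski-open subset U of the s-fold product (P^n)^s such that every tuple (p_1,…,p_s) ∈ U consists of distinct points and the fat point scheme Z = Σ_{i=1}^s m_i p_i satisfies h^1(I_Z(d)) = 0. -/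
open MvPolynomial Module

variable {K : Type*} [Field K]

/-- The homogeneous prime ideal of a point of `ℙⁿ`: the ideal generated by the
linear forms vanishing at the point (equivalently, all homogeneous forms vanishing there). -/
noncomputable def pointIdeal {n : ℕ} (p : Projectivization K (Fin (n + 1) → K)) :
    Ideal (MvPolynomial (Fin (n + 1)) K) :=
  Ideal.span {f | ∃ c : Fin (n + 1) → K,
    (∑ i, c i * p.rep i) = 0 ∧ f = ∑ i, MvPolynomial.C (c i) * MvPolynomial.X i}

/-- The saturated ideal `I_Z = 𝔭₁^{m₁} ∩ ⋯ ∩ 𝔭_s^{m_s}` of the fat point scheme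
`Z = Σ m_i p_i`.  (Points with multiplicity `0` contribute the unit ideal.) -/
noncomputable def fatIdeal {n s : ℕ} (p : Fin s → Projectivization K (Fin (n + 1) → K))
    (m : Fin s → ℕ) : Ideal (MvPolynomial (Fin (n + 1)) K) :=
  ⨅ i, pointIdeal (p i) ^ m i

/-- `dim_K (R/I)_d`: the dimension of the degree-`d` graded piece of `R/I`,
computed as the dimension of the image of the degree-`d` forms in `R/I`. -/
noncomputable def hilbDim {n : ℕ} (I : Ideal (MvPolynomial (Fin (n + 1)) K)) (d : ℕ) : ℕ :=
  Module.finrank K (Submodule.map (Ideal.Quotient.mkₐ K I).toLinearMap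
    (homogeneousSubmodule (Fin (n + 1)) K d))

/-- `Σ_i C(n + m_i − 1, n)`, the expected degree (number of conditions) of a fat point
scheme with multiplicities `m` in `ℙⁿ`. -/
def expDeg {s : ℕ} (n : ℕ) (m : Fin s → ℕ) : ℕ := ∑ i, Nat.choose (n + m i - 1) n

/-- `h¹(I_Z(d)) = 0`, i.e. the fat point scheme imposes independent conditions on
degree-`d` forms. -/
def H1Zero {n s : ℕ} (p : Fin s → Projectivization K (Fin (n + 1) → K)) (m : Fin s → ℕ)
    (d : ℕ) : Prop :=
  hilbDim (fatIdeal p m) d = expDeg n m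

/-- The regularity index of the fat point scheme `Z = Σ m_i p_i`: the least `d ≥ 0`
with `h¹(I_Z(d)) = 0`. -/
noncomputable def regIndex {n s : ℕ} (p : Fin s → Projectivization K (Fin (n + 1) → K))
    (m : Fin s → ℕ) : ℕ :=
  sInf {d | H1Zero p m d}

/-- The set of points of `ℙⁿ` lying in the linear subspace `P(V)`. -/
def projSet {n : ℕ} (V : Submodule K (Fin (n + 1) → K)) :
    Set (Projectivization K (Fin (n + 1) → K)) :=
  {x | x.rep ∈ V}

open Classical in
/-- `w_L(Z)`: the sum of the multiplicities of the points of `Z` lying in `L`. -/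
noncomputable def weightIn {n s : ℕ} (p : Fin s → Projectivization K (Fin (n + 1) → K))
    (m : Fin s → ℕ) (L : Set (Projectivization K (Fin (n + 1) → K))) : ℕ :=
  ∑ i, if p i ∈ L then m i else 0

/-- A polynomial in the `s·(n+1)` cone variables of `(ℙⁿ)ˢ` is multihomogeneous if it is
homogeneous separately in each of the `s` blocks of variables; the non-vanishing of such a
polynomial at a tuple of representatives is independent of the chosen representatives, so
its non-vanishing locus is a (basic) Zariski-open subset of `(ℙⁿ)ˢ`. -/
def MultiHomog {s n : ℕ} (f : MvPolynomial (Fin s × Fin (n + 1)) K) : Prop :=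
  ∃ dd : Fin s → ℕ, ∀ u ∈ f.support, ∀ i : Fin s, (∑ j : Fin (n + 1), u (i, j)) = dd i

/-- Evaluation of a polynomial in the cone variables at the representatives of a tuple of
points of `ℙⁿ`. -/
noncomputable def evalAtReps {n s : ℕ} (p : Fin s → Projectivization K (Fin (n + 1) → K))
    (f : MvPolynomial (Fin s × Fin (n + 1)) K) : K :=
  MvPolynomial.eval (fun v => (p v.1).rep v.2) f

section Vanishing

/-- The translation `f ↦ f(X + v)`. -/
noncomputable def shift {σ : Type*} (v : σ → K) : MvPolynomial σ K →ₐ[K] MvPolynomial σ K :=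
  aeval fun i => X i + C (v i)

/-- The forms of degree `d` vanishing to order `m i` at each of the vectors `v i`. -/
noncomputable def vanishingForms {ι : Type*} (n d : ℕ) (v : ι → Fin (n + 1) → K) (m : ι → ℕ) :
    Submodule K (MvPolynomial (Fin (n + 1)) K) :=
  homogeneousSubmodule (Fin (n + 1)) K d ⊓
    ⨅ i, ((idealOfVars (Fin (n + 1)) K ^ m i).restrictScalars K).comap (shift (v i)).toLinearMap

/-- The number of conditions imposed by a point of multiplicity `m` in projective `n`-space. -/
def jetDim (n m : ℕ) : ℕ := if m = 0 then 0 else (n + m - 1).choose n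

theorem jetDim_zero (n : ℕ) : jetDim n 0 = 0 := rfl

theorem jetDim_succ (n m : ℕ) : jetDim n (m + 1) = (n + m).choose n := by
  simp [jetDim, ← add_assoc]

theorem jetDim_one (n : ℕ) : jetDim n 1 = 1 := by simp [jetDim]

theorem jetDim_pascal (n m : ℕ) : jetDim (n + 1) m = jetDim (n + 1) (m - 1) + jetDim n m := by
  rcases m with _ | m
  · rfl
  rcases m with _ | m
  · simp [jetDim]
  · simp only [Nat.add_sub_cancel, jetDim_succ]
    rw [show n + 1 + (m + 1) = (n + 1 + m) + 1 by ring, Nat.choose_succ_succ, add_comm]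
    congr 2
    ring

theorem jetDim_mono (n : ℕ) : Monotone (jetDim n) := by
  refine monotone_nat_of_le_succ fun m => ?_
  rcases m with _ | m
  · simp [jetDim]
  · rw [jetDim_succ, jetDim_succ]
    exact Nat.choose_le_choose _ (by omega)

theorem mem_vanishingForms {ι : Type*} {n d : ℕ} {v : ι → Fin (n + 1) → K} {m : ι → ℕ}
    {f : MvPolynomial (Fin (n + 1)) K} :
    f ∈ vanishingForms n d v m ↔
      f.IsHomogeneous d ∧ ∀ i, shift (v i) f ∈ idealOfVars (Fin (n + 1)) K ^ m i := by
  simp [vanishingForms]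

theorem isHomogeneous_iff {σ : Type*} {d : ℕ} {f : MvPolynomial σ K} :
    f.IsHomogeneous d ↔ ∀ u, coeff u f ≠ 0 → u.degree = d := by
  simp only [Finsupp.degree_eq_weight_one]
  rfl

theorem mem_homogeneousSubmodule_iff {σ : Type*} [Fintype σ] [DecidableEq σ] {d : ℕ}
    {f : MvPolynomial σ K} : f ∈ homogeneousSubmodule σ K d ↔
      f.support ⊆ Finset.univ.finsuppAntidiag d := by
  rw [mem_homogeneousSubmodule, isHomogeneous_iff, Finset.subset_iff]
  refine forall_congr' fun u => ?_
  simp [Finset.mem_finsuppAntidiag, Finsupp.degree_eq_sum]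

/-- Polynomials supported on a finite set of exponents form a space of the expected dimension. -/
theorem finrank_supported {σ : Type*} (s : Finset (σ →₀ ℕ)) :
    finrank K (restrictSupport K (s : Set (σ →₀ ℕ))) = s.card ∧
    Module.Finite K (restrictSupport K (s : Set (σ →₀ ℕ))) := by
  have e := (basisRestrictSupport K (s : Set (σ →₀ ℕ)))
  refine ⟨?_, Module.Finite.of_basis e⟩
  rw [finrank_eq_card_basis e]
  simp

theorem homogeneousSubmodule_eq_restrictSupport (n d : ℕ) :
    homogeneousSubmodule (Fin n) K d =
      restrictSupport K ((Finset.univ.finsuppAntidiag d : Finset (Fin n →₀ ℕ)) : Set _) := by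
  ext f
  rw [mem_homogeneousSubmodule_iff, mem_restrictSupport_iff, Finset.coe_subset]

instance finite_homogeneousSubmodule (n d : ℕ) :
    Module.Finite K (homogeneousSubmodule (Fin n) K d) := by
  rw [homogeneousSubmodule_eq_restrictSupport]
  exact (finrank_supported _).2

theorem finrank_homogeneousSubmodule (n d : ℕ) :
    finrank K (homogeneousSubmodule (Fin (n + 1)) K d) = (n + d).choose n := by
  rw [homogeneousSubmodule_eq_restrictSupport, (finrank_supported _).1,
    Finset.card_finsuppAntidiag_nat_eq_choose]
  simp only [Finset.card_univ, Fintype.card_fin]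
  rw [show n + 1 + d - 1 = n + d by omega, Nat.choose_symm_add]

instance finite_vanishingForms {ι : Type*} (n d : ℕ) (v : ι → Fin (n + 1) → K) (m : ι → ℕ) :
    Module.Finite K (vanishingForms n d v m) :=
  Submodule.finiteDimensional_of_le inf_le_left

/-- Fat points of multiplicities `m` at suitable vectors impose independent conditions on forms
of degree `d`. -/
def Nonspecial (K : Type*) [Field K] {ι : Type*} [Fintype ι] (n d : ℕ) (m : ι → ℕ) : Prop :=
  ∃ v : ι → Fin (n + 1) → K,
    finrank K (vanishingForms n d v m) + ∑ i, jetDim n (m i) ≤ (n + d).choose n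

theorem finrank_le_map_add {E F : Type*} [AddCommGroup E] [Module K E] [AddCommGroup F]
    [Module K F] (φ : E →ₗ[K] F) (V : Submodule K E) [Module.Finite K V] :
    finrank K V = finrank K (V.map φ) + finrank K (V ⊓ LinearMap.ker φ : Submodule K E) := by
  have h := LinearMap.finrank_range_add_finrank_ker (φ.domRestrict V)
  rw [← h, LinearMap.range_domRestrict]
  congr 1
  rw [LinearMap.ker_domRestrict, ← Submodule.map_comap_subtype]
  exact (Submodule.finrank_map_subtype_eq _ _).symm

end Vanishing

section Restriction

@[simp] theorem shift_X {σ : Type*} (v : σ → K) (i : σ) :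
    shift v (X i) = X i + C (v i) := by simp [shift]

/-- An algebra homomorphism sending each variable into the irrelevant ideal preserves the powers
of that ideal. -/
theorem map_mem_pow_idealOfVars {σ τ : Type*} (φ : MvPolynomial σ K →ₐ[K] MvPolynomial τ K)
    (h : ∀ i, φ (X i) ∈ idealOfVars τ K) {k : ℕ} {f : MvPolynomial σ K}
    (hf : f ∈ idealOfVars σ K ^ k) : φ f ∈ idealOfVars τ K ^ k := by
  have h1 : Ideal.map φ (idealOfVars σ K) ≤ idealOfVars τ K := by
    rw [idealOfVars, Ideal.map_span, Ideal.span_le]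
    rintro _ ⟨_, ⟨i, rfl⟩, rfl⟩
    exact h i
  have h2 := Ideal.mem_map_of_mem φ hf
  rw [Ideal.map_pow] at h2
  exact Ideal.pow_right_mono h1 k h2

theorem X_mem_idealOfVars {σ : Type*} (i : σ) : (X i : MvPolynomial σ K) ∈ idealOfVars σ K :=
  Ideal.subset_span ⟨i, rfl⟩

/-- Specialization of the first variable at a constant. -/
noncomputable def specialize (n : ℕ) (a : K) :
    MvPolynomial (Fin (n + 1)) K →ₐ[K] MvPolynomial (Fin n) K :=
  aeval (Fin.cons (C a) X)

@[simp] theorem specialize_X_zero (n : ℕ) (a : K) : specialize n a (X 0) = C a := by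
  simp [specialize]

@[simp] theorem specialize_X_succ (n : ℕ) (a : K) (j : Fin n) :
    specialize n a (X j.succ) = X j := by simp [specialize]

theorem specialize_shift (n : ℕ) (a : K) (v : Fin (n + 1) → K)
    (f : MvPolynomial (Fin (n + 1)) K) :
    specialize n a (shift v f) = shift (Fin.tail v) (specialize n (a + v 0) f) := by
  have : (specialize n a).comp (shift v) = (shift (Fin.tail v)).comp (specialize n (a + v 0)) := by
    ext j : 1
    refine Fin.cases ?_ (fun j => ?_) j
    · simp [shift]
    · simp [shift, specialize, Fin.tail]
  exact DFunLike.congr_fun this f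

theorem specialize_isHomogeneous {n d : ℕ} {f : MvPolynomial (Fin (n + 1)) K}
    (hf : f.IsHomogeneous d) : (specialize n (0 : K) f).IsHomogeneous d := by
  rw [← one_mul d]
  refine hf.aeval _ fun i => ?_
  refine Fin.cases ?_ (fun j => ?_) i
  · simpa using isHomogeneous_zero _ _ _
  · simpa using isHomogeneous_X _ _

theorem X_zero_dvd_of_specialize_eq_zero {n : ℕ} {f : MvPolynomial (Fin (n + 1)) K}
    (hf : specialize n (0 : K) f = 0) : X 0 ∣ f := by
  set I : Ideal (MvPolynomial (Fin (n + 1)) K) := Ideal.span {X 0}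
  have h : Ideal.Quotient.mkₐ K I =
      ((Ideal.Quotient.mkₐ K I).comp (rename Fin.succ)).comp (specialize n (0 : K)) := by
    ext j : 1
    refine Fin.cases ?_ (fun j => ?_) j
    · simp only [AlgHom.comp_apply, specialize_X_zero, map_zero]
      exact (Ideal.Quotient.eq_zero_iff_mem.2 (Ideal.mem_span_singleton_self _))
    · simp
  have h2 := DFunLike.congr_fun h f
  simp only [AlgHom.comp_apply, hf, map_zero] at h2
  rw [← Ideal.mem_span_singleton]
  exact Ideal.Quotient.eq_zero_iff_mem.1 h2

theorem of_X_mul_isHomogeneous {σ : Type*} {i : σ} {d : ℕ} {f : MvPolynomial σ K}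
    (hf : (X i * f).IsHomogeneous d) : f.IsHomogeneous (d - 1) := by
  rw [isHomogeneous_iff] at *
  intro u hu
  have := hf (Finsupp.single i 1 + u) (by rwa [coeff_X_mul])
  simp at this
  omega

theorem of_X_mul_mem_pow {σ : Type*} {i : σ} {k : ℕ} {f : MvPolynomial σ K}
    (hf : X i * f ∈ idealOfVars σ K ^ k) : f ∈ idealOfVars σ K ^ (k - 1) := by
  rw [mem_pow_idealOfVars_iff'] at *
  intro u hu
  rw [← hf (Finsupp.single i 1 + u) (by simp; omega), coeff_X_mul]

theorem of_X_add_C_mul_mem_pow {σ : Type*} {i : σ} {c : K} (hc : c ≠ 0) {k : ℕ}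
    {f : MvPolynomial σ K} (hf : (X i + C c) * f ∈ idealOfVars σ K ^ k) :
    f ∈ idealOfVars σ K ^ k := by
  suffices ∀ l ≤ k, f ∈ idealOfVars σ K ^ l from this k le_rfl
  intro l hl
  induction l with
  | zero => simp
  | succ l ih =>
    have h1 : X i * f ∈ idealOfVars σ K ^ (l + 1) := by
      rw [pow_succ']
      exact Ideal.mul_mem_mul (X_mem_idealOfVars i) (ih (by omega))
    have h2 := Ideal.sub_mem _ (Ideal.pow_le_pow_right hl hf) h1
    have h3 := Ideal.mul_mem_left _ (C c⁻¹) h2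
    convert h3 using 1
    rw [show C c⁻¹ * ((X i + C c) * f - X i * f) = (C c⁻¹ * C c) * f by ring, ← C_mul,
      inv_mul_cancel₀ hc]
    simp

open Classical in
theorem finrank_vanishingForms_succ_le {ι : Type*} {N d : ℕ} {v : ι → Fin (N + 2) → K}
    {m o m' : ι → ℕ}
    (htrace : ∀ f ∈ vanishingForms (N + 1) (d + 1) v m, ∀ i,
      shift (Fin.tail (v i)) (specialize (N + 1) 0 f) ∈ idealOfVars _ K ^ o i)
    (hres : ∀ i, m' i = if v i 0 = 0 then m i - 1 else m i) :
    finrank K (vanishingForms (N + 1) (d + 1) v m) ≤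
      finrank K (vanishingForms N (d + 1) (fun i => Fin.tail (v i)) o) +
        finrank K (vanishingForms (N + 1) d v m') := by
  rw [finrank_le_map_add (specialize (N + 1) (0 : K)).toLinearMap]
  refine add_le_add (Submodule.finrank_mono ?_) ?_
  · rintro _ ⟨f, hf, rfl⟩
    exact mem_vanishingForms.2 ⟨specialize_isHomogeneous (mem_vanishingForms.1 hf).1,
      htrace f hf⟩
  · refine le_trans (Submodule.finrank_mono (t := (vanishingForms (N + 1) d v m').map
      (LinearMap.mulLeft K (X 0))) ?_) (Submodule.finrank_map_le _ _)
    rintro f ⟨hf, hf0⟩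
    obtain ⟨g, rfl⟩ := X_zero_dvd_of_specialize_eq_zero hf0
    obtain ⟨h1, h2⟩ := mem_vanishingForms.1 hf
    refine ⟨g, mem_vanishingForms.2 ⟨of_X_mul_isHomogeneous h1, fun i => ?_⟩, rfl⟩
    have h3 := h2 i
    rw [map_mul, shift_X] at h3
    rw [hres]
    split_ifs with h0
    · rw [h0, C_0, add_zero] at h3
      exact of_X_mul_mem_pow h3
    · exact of_X_add_C_mul_mem_pow h0 h3

theorem trace_of_zero {N k : ℕ} {v : Fin (N + 1) → K} (hv : v 0 = 0)
    {f : MvPolynomial (Fin (N + 1)) K} (hf : shift v f ∈ idealOfVars _ K ^ k) :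
    shift (Fin.tail v) (specialize N 0 f) ∈ idealOfVars _ K ^ k := by
  have := specialize_shift N 0 v f
  rw [hv, add_zero] at this
  rw [← this]
  refine map_mem_pow_idealOfVars _ (fun i => ?_) hf
  refine Fin.cases ?_ (fun j => ?_) i
  · simp
  · simpa using X_mem_idealOfVars j

theorem aeval_monomial_eq_prod {σ τ : Type*} [Fintype σ] (g : σ → MvPolynomial τ K)
    (u : σ →₀ ℕ) (c : K) : aeval g (monomial u c) = C c * ∏ i, g i ^ u i := by
  rw [aeval_monomial, Finsupp.prod_fintype _ _ (by simp)]
  rfl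

theorem monomial_eq_prod {σ : Type*} [Fintype σ] (u : σ →₀ ℕ) (c : K) :
    monomial u c = C c * ∏ i, X i ^ u i := by
  rw [monomial_eq, Finsupp.prod_fintype _ _ (by simp)]

theorem support_of_vanishing_single {N d k : ℕ} {f : MvPolynomial (Fin (N + 1)) K}
    (hf : f.IsHomogeneous d) {j : Fin (N + 1)}
    (h : shift (Pi.single j (1 : K)) f ∈ idealOfVars _ K ^ k) {u : Fin (N + 1) →₀ ℕ}
    (hu : coeff u f ≠ 0) : u j + k ≤ d := by
  set δ : MvPolynomial (Fin (N + 1)) K →ₐ[K] MvPolynomial (Fin (N + 1)) K :=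
    aeval fun i => if i = j then 1 else X i with hδ
  set π : MvPolynomial (Fin (N + 1)) K →ₐ[K] MvPolynomial (Fin (N + 1)) K :=
    aeval fun i => if i = j then 0 else X i with hπ
  have hcomp : π.comp (shift (Pi.single j 1)) = δ := by
    ext i : 1
    by_cases hi : i = j
    · subst hi
      simp [π, δ]
    · simp [π, δ, hi]
  have h1 : δ f ∈ idealOfVars _ K ^ k := by
    rw [← hcomp]
    refine map_mem_pow_idealOfVars π (fun i => ?_) h
    by_cases hi : i = j
    · simp [π, hi]
    · simpa [π, hi] using X_mem_idealOfVars i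
  have hmon : ∀ w : Fin (N + 1) →₀ ℕ, ∀ c : K, δ (monomial w c) = monomial (w.erase j) c := by
    intro w c
    rw [hδ, aeval_monomial_eq_prod, monomial_eq_prod]
    congr 1
    refine Finset.prod_congr rfl fun i _ => ?_
    by_cases hi : i = j
    · simp [hi]
    · simp [hi]
  have hdeg : ∀ w : Fin (N + 1) →₀ ℕ, w.degree = w j + (w.erase j).degree := by
    intro w
    conv_lhs => rw [← Finsupp.single_add_erase j w]
    simp
  have h2 : coeff (u.erase j) (δ f) = coeff u f := by
    conv_lhs => rw [← support_sum_monomial_coeff f]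
    rw [map_sum, coeff_sum]
    simp only [hmon, coeff_monomial]
    rw [Finset.sum_eq_single u]
    · simp
    · intro w hw hwu
      rw [if_neg]
      intro he
      apply hwu
      have a1 := isHomogeneous_iff.1 hf w (MvPolynomial.mem_support_iff.1 hw)
      have a2 := isHomogeneous_iff.1 hf u hu
      have : w j = u j := by
        rw [hdeg] at a1 a2
        rw [he] at a1
        omega
      rw [← Finsupp.single_add_erase j w, ← Finsupp.single_add_erase j u, he, this]
    · intro hu'
      exact absurd (MvPolynomial.mem_support_iff.2 hu) hu'
  have h3 : k ≤ (u.erase j).degree :=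
    (mem_pow_idealOfVars_iff _ _).1 h1 _ (MvPolynomial.mem_support_iff.2 (by rwa [h2]))
  have h4 := isHomogeneous_iff.1 hf u hu
  rw [hdeg] at h4
  omega

theorem degreeOf_shift_le {N : ℕ} (f : MvPolynomial (Fin (N + 1)) K) (v : Fin (N + 1) → K) :
    degreeOf 0 (shift v f) ≤ degreeOf 0 f := by
  conv_lhs => rw [← support_sum_monomial_coeff f]
  rw [map_sum]
  refine (degreeOf_sum_le _ _ _).trans (Finset.sup_le fun u hu => ?_)
  rw [shift, aeval_monomial_eq_prod]
  refine (degreeOf_C_mul_le _ _ _).trans ((degreeOf_prod_le _ _ _).trans ?_)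
  rw [Fin.sum_univ_succ]
  have h0 : degreeOf 0 ((X 0 + C (v 0) : MvPolynomial (Fin (N + 1)) K) ^ u 0) ≤ u 0 := by
    refine (degreeOf_pow_le _ _ _).trans ?_
    have : degreeOf 0 (X 0 + C (v 0) : MvPolynomial (Fin (N + 1)) K) ≤ 1 := by
      refine (degreeOf_add_le _ _ _).trans ?_
      simp
    nlinarith
  have h1 : ∀ j : Fin N, degreeOf 0
      ((X j.succ + C (v j.succ) : MvPolynomial (Fin (N + 1)) K) ^ u j.succ) = 0 := by
    intro j
    have : degreeOf 0 (X j.succ + C (v j.succ) : MvPolynomial (Fin (N + 1)) K) ≤ 0 := by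
      refine (degreeOf_add_le _ _ _).trans ?_
      simp [degreeOf_X, (Fin.succ_ne_zero j).symm]
    have h2 := degreeOf_pow_le (R := K) 0
      (X j.succ + C (v j.succ) : MvPolynomial (Fin (N + 1)) K) (u j.succ)
    nlinarith
  simp only [h1, Finset.sum_const_zero, add_zero]
  exact h0.trans (monomial_le_degreeOf 0 hu)

theorem trace_of_line {N d b k : ℕ} {v : Fin (N + 1) → K} (hv : v 0 = 1)
    {f : MvPolynomial (Fin (N + 1)) K} (hf : f.IsHomogeneous d)
    (h0 : shift (Pi.single 0 (1 : K)) f ∈ idealOfVars _ K ^ k)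
    (hb : shift v f ∈ idealOfVars _ K ^ b) :
    shift (Fin.tail v) (specialize N 0 f) ∈ idealOfVars _ K ^ (k + b - d) := by
  by_cases hf0 : f = 0
  · simp [hf0]
  have hk : k ≤ d := by
    obtain ⟨u, hu⟩ := ne_zero_iff.1 hf0
    have := support_of_vanishing_single hf h0 hu
    omega
  have hdeg : degreeOf 0 f ≤ d - k := by
    rw [degreeOf_le_iff]
    intro u hu
    have := support_of_vanishing_single hf h0 (MvPolynomial.mem_support_iff.1 hu)
    omega
  have := specialize_shift N (-1) v f
  rw [hv, neg_add_cancel] at this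
  rw [← this, ← support_sum_monomial_coeff (shift v f), map_sum]
  refine Ideal.sum_mem _ fun u hu => ?_
  have h1 := (monomial_le_degreeOf 0 hu).trans ((degreeOf_shift_le f v).trans hdeg)
  have h2 := (mem_pow_idealOfVars_iff _ _).1 hb u hu
  rw [specialize, aeval_monomial_eq_prod, Fin.prod_univ_succ]
  simp only [Fin.cons_zero, Fin.cons_succ]
  refine Ideal.mul_mem_left _ _ (Ideal.mul_mem_left _ _ ?_)
  have h3 : (∏ j : Fin N, (X j : MvPolynomial (Fin N) K) ^ u j.succ) =
      monomial (Finsupp.tail u) 1 := by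
    rw [monomial_eq_prod, C_1, one_mul]
    rfl
  rw [h3, monomial_mem_pow_idealOfVars_iff _ _ one_ne_zero]
  rw [Finsupp.degree_eq_sum, Fin.sum_univ_succ] at h2
  rw [Finsupp.degree_eq_sum]
  simp only [Finsupp.tail_apply]
  omega

end Restriction

section Layering

open Classical in
/-- The vectors of a configuration with a vertex `i₀` at the first coordinate vector, the vectors
indexed by `B` off the hyperplane `X₀ = 0`, and the others on it. -/
noncomputable def coneVectors {ι : Type*} {N : ℕ} (i₀ : ι) (B : Finset ι)
    (q : ι → Fin (N + 1) → K) (i : ι) : Fin (N + 2) → K :=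
  if i = i₀ then Pi.single 0 1 else Fin.cons (if i ∈ B then 1 else 0) (q i)

open Classical in
/-- The orders of vanishing of the `k`-th residual traces on the hyperplane `X₀ = 0`, in
degree `l`. -/
noncomputable def layerMult {ι : Type*} (i₀ : ι) (B : Finset ι) (k l : ℕ) (t : ι → ℕ)
    (i : ι) : ℕ :=
  if i = i₀ then 0 else if i ∈ B then t i₀ + t i - l else t i - k

theorem coneVectors_vertex {ι : Type*} {N : ℕ} (i₀ : ι) (B : Finset ι)
    (q : ι → Fin (N + 1) → K) : coneVectors i₀ B q i₀ = Pi.single 0 1 := if_pos rfl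

theorem tail_coneVectors {ι : Type*} {N : ℕ} {i₀ : ι} {B : Finset ι}
    {q : ι → Fin (N + 1) → K} {i : ι} (hi : i ≠ i₀) : Fin.tail (coneVectors i₀ B q i) = q i := by
  simp [coneVectors, hi]

open Classical in
theorem layering {ι : Type*} [Fintype ι] {N : ℕ} (i₀ : ι) (B : Finset ι) (hB : i₀ ∉ B)
    (q : ι → Fin (N + 1) → K) (μ k : ℕ) (t : ι → ℕ) (h0 : t i₀ = μ + 1)
    (hT : ∀ i, i ≠ i₀ → i ∉ B → t i ≤ k)
    (hlayer : ∀ j l, l + j = μ + k → μ + 1 ≤ l →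
      finrank K (vanishingForms N l q (layerMult i₀ B j l t)) +
        ∑ i, jetDim N (layerMult i₀ B j l t i) ≤ (N + l).choose N) :
    finrank K (vanishingForms (N + 1) (μ + k) (coneVectors i₀ B q) t) +
      ∑ i, jetDim (N + 1) (t i) ≤ (N + 1 + (μ + k)).choose (N + 1) +
      ∑ i, if i ∈ B then jetDim (N + 1) (t i - k) else 0 := by
  induction k generalizing t with
  | zero =>
    have hV : vanishingForms (N + 1) (μ + 0) (coneVectors i₀ B q) t = ⊥ := by
      rw [eq_bot_iff]
      intro f hf
      obtain ⟨h1, h2⟩ := mem_vanishingForms.1 hf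
      have h3 := h2 i₀
      rw [coneVectors_vertex] at h3
      rw [Submodule.mem_bot]
      by_contra hne
      obtain ⟨u, hu⟩ := ne_zero_iff.1 hne
      have := support_of_vanishing_single h1 h3 hu
      omega
    rw [hV, finrank_bot, zero_add]
    have h1 : ∀ i, jetDim (N + 1) (t i) = (if i = i₀ then jetDim (N + 1) (t i₀) else 0) +
        (if i ∈ B then jetDim (N + 1) (t i - 0) else 0) := by
      intro i
      by_cases hi : i = i₀
      · subst hi
        simp [hB]
      · by_cases hiB : i ∈ B
        · simp [hi, hiB]
        · simp [hi, hiB, Nat.le_zero.1 (hT i hi hiB), jetDim_zero]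
    rw [Finset.sum_congr rfl fun i _ => h1 i, Finset.sum_add_distrib]
    simp [h0, jetDim_succ]
  | succ k ih =>
    set t' : ι → ℕ := fun i => if coneVectors i₀ B q i 0 = 0 then t i - 1 else t i with ht'
    have t0 : t' i₀ = t i₀ := by simp [t', coneVectors]
    have tB : ∀ i, i ∈ B → t' i = t i := by
      intro i hi
      have : i ≠ i₀ := fun h => hB (h ▸ hi)
      simp [t', coneVectors, this, hi]
    have tT : ∀ i, i ≠ i₀ → i ∉ B → t' i = t i - 1 := by
      intro i hi hi'
      simp [t', coneVectors, hi, hi']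
    have hrec := ih t' (t0.trans h0) (fun i hi hi' => by
      rw [tT i hi hi']
      have := hT i hi hi'
      omega) (fun j l hl hl' => by
        have : layerMult i₀ B j l t' = layerMult i₀ B (j + 1) l t := by
          funext i
          simp only [layerMult]
          split_ifs with a1 a2
          · rfl
          · rw [t0, tB i a2]
          · rw [tT i a1 a2]
            omega
        rw [this]
        exact hlayer (j + 1) l (by omega) hl')
    have htop := hlayer 0 (μ + (k + 1)) rfl (by omega)
    have hhor := finrank_vanishingForms_succ_le (K := K) (N := N) (d := μ + k)
      (v := coneVectors i₀ B q) (m := t) (o := layerMult i₀ B 0 (μ + (k + 1)) t) (m' := t')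
      (by
        intro f hf i
        obtain ⟨h1, h2⟩ := mem_vanishingForms.1 hf
        have h3 := h2 i
        by_cases hi : i = i₀
        · simp [layerMult, hi]
        · by_cases hiB : i ∈ B
          · have h4 := h2 i₀
            rw [coneVectors_vertex] at h4
            have := trace_of_line (v := coneVectors i₀ B q i) (by simp [coneVectors, hi, hiB])
              h1 h4 h3
            simpa [layerMult, hi, hiB, add_assoc] using this
          · have := trace_of_zero (v := coneVectors i₀ B q i) (by simp [coneVectors, hi, hiB]) h3
            simpa [layerMult, hi, hiB] using this)
      (fun i => rfl)
    have hcongr : vanishingForms N (μ + k + 1) (fun i => Fin.tail (coneVectors i₀ B q i))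
        (layerMult i₀ B 0 (μ + (k + 1)) t) =
        vanishingForms N (μ + (k + 1)) q (layerMult i₀ B 0 (μ + (k + 1)) t) := by
      ext f
      simp only [mem_vanishingForms, add_assoc]
      refine and_congr_right fun _ => forall_congr' fun i => ?_
      by_cases hi : i = i₀
      · simp [layerMult, hi]
      · rw [tail_coneVectors hi]
    rw [hcongr] at hhor
    have hpt : ∀ i, jetDim (N + 1) (t i) + (if i ∈ B then jetDim (N + 1) (t' i - k) else 0) =
        jetDim N (layerMult i₀ B 0 (μ + (k + 1)) t i) + jetDim (N + 1) (t' i) +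
          (if i ∈ B then jetDim (N + 1) (t i - (k + 1)) else 0) := by
      intro i
      by_cases hi : i = i₀
      · subst hi
        simp [layerMult, hB, t0, jetDim_zero]
      · by_cases hiB : i ∈ B
        · simp only [layerMult, hi, hiB, if_true, if_false, tB i hiB, h0]
          rw [jetDim_pascal N (t i - k), show μ + 1 + t i - (μ + (k + 1)) = t i - k by omega,
            show t i - k - 1 = t i - (k + 1) by omega]
          ring
        · simp only [layerMult, hi, hiB, if_false, tT i hi hiB, add_zero]
          rw [jetDim_pascal N (t i), Nat.sub_zero, add_comm]
    have hsum := Finset.sum_congr (rfl : (Finset.univ : Finset ι) = _) fun i _ => hpt i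
    simp only [Finset.sum_add_distrib] at hsum
    have hch : (N + 1 + (μ + (k + 1))).choose (N + 1) =
        (N + (μ + (k + 1))).choose N + (N + 1 + (μ + k)).choose (N + 1) := by
      rw [show N + 1 + (μ + (k + 1)) = (N + (μ + (k + 1))) + 1 by ring, Nat.choose_succ_succ]
      congr 2
      ring
    rw [hch]
    rw [show μ + k + 1 = μ + (k + 1) by ring] at hhor
    omega

end Layering

section Minors

theorem exists_fin_linearIndependent {E ρ : Type*} [AddCommGroup E] [Module K E]
    [Module.Finite K E] (x : ρ → E) {R : ℕ}
    (h : R ≤ finrank K (Submodule.span K (Set.range x))) :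
    ∃ r : Fin R → ρ, LinearIndependent K (x ∘ r) := by
  obtain ⟨κ, a, -, hs, hli⟩ := exists_linearIndependent' K x
  have : Fintype κ := @Fintype.ofFinite _ hli.finite
  rw [← hs, finrank_span_eq_card hli] at h
  rw [← Fintype.card_fin R] at h
  obtain ⟨e⟩ := Function.Embedding.nonempty_of_card_le h
  exact ⟨a ∘ e, hli.comp e e.injective⟩

theorem exists_minor_ne_zero {E ρ S : Type*} [AddCommGroup E] [Module K E]
    [Module.Finite K E] [Fintype S] (b : S → E) (hb : Submodule.span K (Set.range b) = ⊤)
    (l : ρ → Dual K E) {R : ℕ}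
    (h : finrank K (⨅ r, LinearMap.ker (l r) : Submodule K E) + R ≤ finrank K E) :
    ∃ (r : Fin R → ρ) (s : Fin R → S), (Matrix.of fun i j => l (r i) (b (s j))).det ≠ 0 := by
  have h1 : (Submodule.span K (Set.range l)).dualCoannihilator = ⨅ r, LinearMap.ker (l r) := by
    ext f
    have := Submodule.coe_dualCoannihilator_span (R := K) (M := E) (Set.range l)
    rw [← SetLike.mem_coe, this]
    simp
  have h2 := Subspace.finrank_add_finrank_dualCoannihilator_eq (Submodule.span K (Set.range l))
  rw [h1] at h2
  obtain ⟨r, hr⟩ := exists_fin_linearIndependent l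
    (show R ≤ finrank K (Submodule.span K (Set.range l)) by omega)
  let ev : Dual K E →ₗ[K] (S → K) := LinearMap.pi fun s => Dual.eval K E (b s)
  have hev : LinearMap.ker ev = ⊥ := by
    rw [LinearMap.ker_eq_bot']
    intro φ hφ
    refine LinearMap.ext_on_range hb fun s => ?_
    exact congr_fun hφ s
  have hli := hr.map' ev hev
  let A : Matrix (Fin R) S K := Matrix.of fun i s => l (r i) (b s)
  have hA : A.rank = R := by
    have := LinearIndependent.rank_matrix (M := A) hli
    simpa using this
  rw [Matrix.rank_eq_finrank_span_cols] at hA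
  obtain ⟨s, hs⟩ := exists_fin_linearIndependent _ hA.ge
  refine ⟨r, s, ?_⟩
  have h3 : LinearIndependent K (Matrix.of fun i j => l (r i) (b (s j))).col := hs
  rw [Matrix.linearIndependent_cols_iff_isUnit, Matrix.isUnit_iff_isUnit_det] at h3
  exact h3.ne_zero

theorem finrank_add_le_of_minor_ne_zero {E ρ : Type*} [AddCommGroup E] [Module K E]
    [Module.Finite K E] (l : ρ → Dual K E) {R : ℕ} (r : Fin R → ρ) (x : Fin R → E)
    (h : (Matrix.of fun i j => l (r i) (x j)).det ≠ 0) :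
    finrank K (⨅ r, LinearMap.ker (l r) : Submodule K E) + R ≤ finrank K E := by
  let L : E →ₗ[K] (Fin R → K) := LinearMap.pi fun i => l (r i)
  have h1 : LinearIndependent K (Matrix.of fun i j => l (r i) (x j)).col := by
    rw [Matrix.linearIndependent_cols_iff_isUnit, Matrix.isUnit_iff_isUnit_det]
    exact h.isUnit
  have h2 : R ≤ finrank K (LinearMap.range L) := by
    have h3 := finrank_span_eq_card h1
    rw [Fintype.card_fin] at h3
    refine h3.ge.trans ?_
    refine Submodule.finrank_mono ?_
    rw [Submodule.span_le]
    rintro _ ⟨j, rfl⟩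
    exact ⟨x j, rfl⟩
  have h4 := LinearMap.finrank_range_add_finrank_ker L
  have h5 : finrank K (⨅ r, LinearMap.ker (l r) : Submodule K E) ≤ finrank K (LinearMap.ker L) := by
    refine Submodule.finrank_mono fun f hf => ?_
    rw [Submodule.mem_iInf] at hf
    rw [LinearMap.mem_ker]
    funext i
    exact hf (r i)
  omega

end Minors

section Genericity

/-- The block weight on the cone variables of a product of projective spaces. -/
noncomputable def blockWeight (ι τ : Type*) [DecidableEq ι] (x : ι × τ) : ι → ℕ :=
  Pi.single x.1 1

theorem coeff_prod_X_add_C {σ : Type*} [Fintype σ] (a : σ → K) (β u : σ →₀ ℕ) :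
    coeff u (∏ k, (X k + C (a k)) ^ β k : MvPolynomial σ K) =
      ∏ k, ((β k).choose (u k) : K) * a k ^ (β k - u k) := by
  classical
  have h1 : ∀ k, (X k + C (a k) : MvPolynomial σ K) ^ β k =
      ∑ j ∈ Finset.range (β k + 1), C (((β k).choose j : K) * a k ^ (β k - j)) * X k ^ j := by
    intro k
    rw [add_pow]
    refine Finset.sum_congr rfl fun j _ => ?_
    simp only [map_mul, map_pow, map_natCast]
    ring
  simp only [h1]
  rw [Finset.prod_univ_sum, coeff_sum]
  have h2 : ∀ p : σ → ℕ, (∏ k, C (((β k).choose (p k) : K) * a k ^ (β k - p k)) * X k ^ p k :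
      MvPolynomial σ K) = monomial (Finsupp.equivFunOnFinite.symm p)
        (∏ k, ((β k).choose (p k) : K) * a k ^ (β k - p k)) := by
    intro p
    rw [Finset.prod_mul_distrib, monomial_eq_prod, map_prod]
    rfl
  simp only [h2, coeff_monomial]
  rw [Finset.sum_eq_single (u : σ → ℕ)]
  · rw [if_pos (by ext; rfl)]
  · intro p _ hp
    rw [if_neg]
    rintro rfl
    exact hp rfl
  · intro hu
    have : ∃ k, β k < u k := by
      by_contra hcon
      push Not at hcon
      apply hu
      rw [Fintype.mem_piFinset]
      intro k
      rw [Finset.mem_range]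
      exact Nat.lt_succ_of_le (hcon k)
    obtain ⟨k, hk⟩ := this
    rw [if_pos (by ext; rfl)]
    refine Finset.prod_eq_zero (Finset.mem_univ k) ?_
    rw [Nat.choose_eq_zero_of_lt hk]
    simp

/-- The condition on the coefficient of the monomial with exponent `β` expressing that the Taylor
coefficient with exponent `u` at the `i`-th vector is zero. -/
noncomputable def jetEntry {ι : Type*} {n : ℕ} (i : ι) (u β : Fin (n + 1) →₀ ℕ) :
    MvPolynomial (ι × Fin (n + 1)) K :=
  ∏ k, (C ((β k).choose (u k) : K) * X (i, k) ^ (β k - u k))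

theorem eval_jetEntry {ι : Type*} {n : ℕ} (i : ι) (u β : Fin (n + 1) →₀ ℕ)
    (v : ι → Fin (n + 1) → K) :
    eval (fun x => v x.1 x.2) (jetEntry i u β) = coeff u (shift (v i) (monomial β 1)) := by
  rw [shift, aeval_monomial_eq_prod, C_1, one_mul, coeff_prod_X_add_C, jetEntry, map_prod]
  simp

theorem jetEntry_isWeightedHomogeneous {ι : Type*} [DecidableEq ι] {n d : ℕ} (i : ι)
    (u β : Fin (n + 1) →₀ ℕ) (hβ : β.degree = d) :
    IsWeightedHomogeneous (blockWeight ι (Fin (n + 1))) (jetEntry (K := K) i u β)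
      (Pi.single i (d - u.degree)) := by
  by_cases hu : ∃ k, β k < u k
  · obtain ⟨k, hk⟩ := hu
    have : jetEntry (K := K) i u β = 0 := by
      refine Finset.prod_eq_zero (Finset.mem_univ k) ?_
      rw [Nat.choose_eq_zero_of_lt hk]
      simp
    rw [this]
    exact isWeightedHomogeneous_zero _ _ _
  · push Not at hu
    have h1 : (Pi.single i (d - u.degree) : ι → ℕ) =
        ∑ k, (β k - u k) • blockWeight ι (Fin (n + 1)) (i, k) := by
      simp only [blockWeight]
      rw [← Finset.sum_smul, ← Pi.single_smul, smul_eq_mul, mul_one,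
        Finset.sum_tsub_distrib _ fun k _ => hu k, ← hβ, Finsupp.degree_eq_sum,
        Finsupp.degree_eq_sum]
    rw [h1]
    exact IsWeightedHomogeneous.prod _ _ _ fun k _ =>
      ((isWeightedHomogeneous_X K _ _).pow _).C_mul _

/-- If some configuration has the expected dimension, then so has a generic one. -/
theorem exists_genericity_polynomial {ι : Type*} [Fintype ι] [DecidableEq ι] {n d : ℕ}
    {m : ι → ℕ} (h : Nonspecial K n d m) :
    ∃ F : MvPolynomial (ι × Fin (n + 1)) K,
      (∃ w, IsWeightedHomogeneous (blockWeight ι (Fin (n + 1))) F w) ∧ F ≠ 0 ∧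
      ∀ v : ι → Fin (n + 1) → K, eval (fun x => v x.1 x.2) F ≠ 0 →
        finrank K (vanishingForms n d v m) + ∑ i, jetDim n (m i) ≤ (n + d).choose n := by
  obtain ⟨v₀, hv₀⟩ := h
  let E := homogeneousSubmodule (Fin (n + 1)) K d
  let ρ := Σ i : ι, {u : Fin (n + 1) →₀ ℕ // u.degree < m i}
  let T : Finset (Fin (n + 1) →₀ ℕ) := Finset.univ.finsuppAntidiag d
  let S := {β // β ∈ T}
  let _ : Fintype S := FinsetCoe.fintype T
  let l : (ι → Fin (n + 1) → K) → ρ → Dual K E := fun v r =>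
    (lcoeff K r.2.1).comp ((shift (v r.1)).toLinearMap.comp E.subtype)
  have hSdeg : ∀ s : S, s.1.degree = d := by
    intro s
    have := s.2
    rw [Finset.mem_finsuppAntidiag] at this
    rw [Finsupp.degree_eq_sum]
    exact this.1
  let b : S → E := fun s => ⟨monomial s.1 1, isHomogeneous_monomial _ (hSdeg s)⟩
  have hb : Submodule.span K (Set.range b) = ⊤ := by
    rw [eq_top_iff]
    rintro ⟨f, hf⟩ -
    have h1 : (⟨f, hf⟩ : E) = ∑ s : S, coeff s.1 f • b s := by
      apply Subtype.ext
      rw [AddSubmonoidClass.coe_finsetSum]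
      simp only [Submodule.coe_smul, b, smul_monomial, smul_eq_mul, mul_one]
      rw [Finset.sum_coe_sort T (fun s => monomial s (coeff s f))]
      conv_lhs => rw [← support_sum_monomial_coeff f]
      refine Finset.sum_subset (mem_homogeneousSubmodule_iff.1 hf) fun u _ hu => ?_
      rw [MvPolynomial.notMem_support_iff.1 hu, monomial_zero]
    rw [h1]
    exact Submodule.sum_mem _ fun s _ => Submodule.smul_mem _ _ (Submodule.subset_span ⟨s, rfl⟩)
  have hV : ∀ v : ι → Fin (n + 1) → K,
      finrank K (⨅ r, LinearMap.ker (l v r) : Submodule K E) =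
        finrank K (vanishingForms n d v m) := by
    intro v
    have h1 : (⨅ r, LinearMap.ker (l v r) : Submodule K E) =
        (vanishingForms n d v m).comap E.subtype := by
      ext ⟨f, hf⟩
      rw [Submodule.mem_iInf, Submodule.mem_comap, mem_vanishingForms]
      simp only [mem_pow_idealOfVars_iff', LinearMap.mem_ker]
      constructor
      · intro h
        exact ⟨hf, fun i u hu => h ⟨i, u, hu⟩⟩
      · intro h r
        exact h.2 r.1 r.2.1 r.2.2
    rw [h1]
    exact (Submodule.comapSubtypeEquivOfLe inf_le_left).finrank_eq
  have hE : finrank K E = (n + d).choose n := finrank_homogeneousSubmodule n d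
  obtain ⟨r, s, hrs⟩ := exists_minor_ne_zero b hb (l v₀) (R := ∑ i, jetDim n (m i))
    (by rw [hV, hE]; exact hv₀)
  let M : Matrix (Fin (∑ i, jetDim n (m i))) (Fin (∑ i, jetDim n (m i)))
    (MvPolynomial (ι × Fin (n + 1)) K) :=
    Matrix.of fun i j => jetEntry (r i).1 (r i).2.1 (s j).1
  have hM : ∀ v : ι → Fin (n + 1) → K, eval (fun x => v x.1 x.2) M.det =
      (Matrix.of fun i j => l v (r i) (b (s j))).det := by
    intro v
    rw [RingHom.map_det]
    congr 1
    ext i j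
    exact eval_jetEntry _ _ _ _
  refine ⟨M.det, ⟨∑ i, Pi.single (r i).1 (d - (r i).2.1.degree), ?_⟩, ?_, ?_⟩
  · rw [Matrix.det_apply]
    refine IsWeightedHomogeneous.sum _ _ _ fun σ _ => ?_
    have h1 : IsWeightedHomogeneous (blockWeight ι (Fin (n + 1))) (∏ i, M (σ i) i)
        (∑ i, Pi.single (r i).1 (d - (r i).2.1.degree)) := by
      rw [← Equiv.sum_comp σ]
      exact IsWeightedHomogeneous.prod _ _ _ fun i _ =>
        jetEntry_isWeightedHomogeneous _ _ _ (hSdeg _)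
    rcases Int.units_eq_one_or (Equiv.Perm.sign σ) with hs | hs
    · rw [hs, one_smul]
      exact h1
    · rw [hs, Units.neg_smul, one_smul]
      exact h1.neg
  · intro h0
    apply hrs
    rw [← hM, h0, map_zero]
  · intro v hv
    rw [← hV, ← hE]
    refine finrank_add_le_of_minor_ne_zero (l v) r (b ∘ s) ?_
    rw [hM] at hv
    exact hv

/-- A nonzero polynomial takes a nonzero value at some configuration. -/
theorem exists_eval_ne_zero [Infinite K] {ι : Type*} {n : ℕ}
    {F : MvPolynomial (ι × Fin (n + 1)) K} (hF : F ≠ 0) :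
    ∃ v : ι → Fin (n + 1) → K, eval (fun x => v x.1 x.2) F ≠ 0 := by
  by_contra hcon
  push Not at hcon
  apply hF
  refine MvPolynomial.funext fun x => ?_
  rw [map_zero]
  exact hcon fun i j => x (i, j)

end Genericity

section Coordinate

theorem card_filter_antidiag (n d c : ℕ) (hc : c ≤ d + 1) (j : Fin (n + 1)) :
    ((Finset.univ.finsuppAntidiag d : Finset (Fin (n + 1) →₀ ℕ)).filter
      fun u => d < u j + c).card = jetDim n c := by
  rcases c with _ | c
  · rw [jetDim_zero, Finset.card_eq_zero, Finset.filter_eq_empty_iff]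
    intro u hu
    rw [Finset.mem_finsuppAntidiag] at hu
    have := Finset.single_le_sum (f := u) (fun _ _ => Nat.zero_le _) (Finset.mem_univ j)
    have h2 : ∑ x, u x = d := hu.1
    omega
  · have h1 : (Finset.univ.finsuppAntidiag d : Finset (Fin (n + 1) →₀ ℕ)).filter
        (fun u => d < u j + (c + 1)) =
        (Finset.univ.finsuppAntidiag c).image fun u => u + Finsupp.single j (d - c) := by
      ext u
      simp only [Finset.mem_filter, Finset.mem_image, Finset.mem_finsuppAntidiag,
        Finset.subset_univ, and_true]
      constructor
      · rintro ⟨hu, hj⟩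
        have hle : Finsupp.single j (d - c) ≤ u := by
          rw [Finsupp.single_le_iff]
          omega
        refine ⟨u - Finsupp.single j (d - c), ?_, tsub_add_cancel_of_le hle⟩
        change ∑ x, u x = d at hu
        change ∑ x, (u - Finsupp.single j (d - c)) x = c
        have h2 := congrArg Finsupp.degree (tsub_add_cancel_of_le hle)
        rw [map_add, Finsupp.degree_single, Finsupp.degree_eq_sum, Finsupp.degree_eq_sum, hu] at h2
        omega
      · rintro ⟨w, hw, rfl⟩
        constructor
        · change ∑ i, (w + Finsupp.single j (d - c)) i = d
          rw [← Finsupp.degree_eq_sum, map_add, Finsupp.degree_single, Finsupp.degree_eq_sum, hw]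
          omega
        · simp
          omega
    rw [h1, Finset.card_image_of_injective _ (add_left_injective _),
      Finset.card_finsuppAntidiag_nat_eq_choose, jetDim_succ]
    simp only [Finset.card_univ, Fintype.card_fin]
    rw [show n + 1 + c - 1 = n + c by omega, Nat.choose_symm_add]

theorem finrank_add_le_of_coordinate_points {ι : Type*} [Fintype ι] {n d : ℕ} {c : ι → ℕ}
    {A : Finset ι} {e : ι → Fin (n + 1)} (he : Set.InjOn e A) {v : ι → Fin (n + 1) → K}
    (hv : ∀ i ∈ A, v i = Pi.single (e i) 1) (hc : ∀ i, i ∉ A → c i = 0)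
    (h1 : ∀ i, c i ≤ d + 1) (h2 : ∀ i ∈ A, ∀ j ∈ A, i ≠ j → c i + c j ≤ d + 1) :
    finrank K (vanishingForms n d v c) + ∑ i, jetDim n (c i) ≤ (n + d).choose n := by
  classical
  set S : Finset (Fin (n + 1) →₀ ℕ) := Finset.univ.finsuppAntidiag d with hS
  have hcardS : S.card = (n + d).choose n := by
    rw [hS, Finset.card_finsuppAntidiag_nat_eq_choose]
    simp only [Finset.card_univ, Fintype.card_fin]
    rw [show n + 1 + d - 1 = n + d by omega, Nat.choose_symm_add]
  let B : ι → Finset (Fin (n + 1) →₀ ℕ) := fun i => S.filter fun u => d < u (e i) + c i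
  have hB : ∀ i, (B i).card = jetDim n (c i) := fun i => card_filter_antidiag n d (c i) (h1 i) _
  let S' := S.filter fun u => ∀ i ∈ A, u (e i) + c i ≤ d
  have hV : finrank K (vanishingForms n d v c) ≤ S'.card := by
    rw [← (finrank_supported (K := K) S').1]
    have := (finrank_supported (K := K) S').2
    refine Submodule.finrank_mono fun f hf => ?_
    obtain ⟨hf1, hf2⟩ := mem_vanishingForms.1 hf
    rw [mem_restrictSupport_iff]
    intro u hu
    rw [Finset.mem_coe] at hu ⊢
    refine Finset.mem_filter.2 ⟨mem_homogeneousSubmodule_iff.1 hf1 hu, fun i hi => ?_⟩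
    have h3 := hf2 i
    rw [hv i hi] at h3
    exact support_of_vanishing_single hf1 h3 (MvPolynomial.mem_support_iff.1 hu)
  have hdisj : (A : Set ι).PairwiseDisjoint B := by
    intro i hi j hj hij
    rw [Function.onFun, Finset.disjoint_left]
    intro u hui huj
    simp only [B, Finset.mem_filter] at hui huj
    have hij' : e i ≠ e j := fun h => hij (he hi hj h)
    have h3 := h2 i hi j hj hij
    have h4 : u (e i) + u (e j) ≤ d := by
      have h5 := hui.1
      rw [hS, Finset.mem_finsuppAntidiag] at h5
      have h6 : ∑ k, u k = d := h5.1
      rw [← h6, ← Finset.sum_pair hij']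
      exact Finset.sum_le_sum_of_subset (Finset.subset_univ _)
    omega
  have hsum : ∑ i, jetDim n (c i) = (A.biUnion B).card := by
    rw [Finset.card_biUnion hdisj]
    simp only [hB]
    refine (Finset.sum_subset (Finset.subset_univ A) fun i _ hi => ?_).symm
    rw [hc i hi, jetDim_zero]
  have hdisj2 : Disjoint S' (A.biUnion B) := by
    rw [Finset.disjoint_left]
    intro u hu hu2
    obtain ⟨i, hi, hui⟩ := Finset.mem_biUnion.1 hu2
    have h3 := (Finset.mem_filter.1 hu).2 i hi
    have h4 := (Finset.mem_filter.1 hui).2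
    omega
  rw [hsum, ← hcardS]
  refine (Nat.add_le_add_right hV _).trans ?_
  rw [← Finset.card_union_of_disjoint hdisj2]
  refine Finset.card_le_card (Finset.union_subset (Finset.filter_subset _ _) ?_)
  exact Finset.biUnion_subset.2 fun i _ => Finset.filter_subset _ _

end Coordinate

section Linear

/-- Linear substitution of variables. -/
noncomputable def linSubst {n : ℕ} (g : Matrix (Fin n) (Fin n) K) :
    MvPolynomial (Fin n) K →ₐ[K] MvPolynomial (Fin n) K :=
  aeval fun i => ∑ j, C (g i j) * X j

theorem linSubst_X {n : ℕ} (g : Matrix (Fin n) (Fin n) K) (i : Fin n) :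
    linSubst g (X i) = ∑ j, C (g i j) * X j := by simp [linSubst]

theorem linSubst_linSubst {n : ℕ} (g h : Matrix (Fin n) (Fin n) K) (f : MvPolynomial (Fin n) K) :
    linSubst h (linSubst g f) = linSubst (g * h) f := by
  have : (linSubst h).comp (linSubst g) = linSubst (g * h) := by
    ext i : 1
    simp only [AlgHom.comp_apply, linSubst_X, map_sum, map_mul, Matrix.mul_apply, Finset.sum_mul,
      Finset.mul_sum, algHom_C, algebraMap_eq]
    rw [Finset.sum_comm]
    refine Finset.sum_congr rfl fun k _ => Finset.sum_congr rfl fun j _ => ?_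
    ring
  exact DFunLike.congr_fun this f

theorem linSubst_one {n : ℕ} (f : MvPolynomial (Fin n) K) : linSubst 1 f = f := by
  have : linSubst (1 : Matrix (Fin n) (Fin n) K) = AlgHom.id K _ := by
    ext i : 1
    simp [linSubst_X, Matrix.one_apply]
  rw [this]
  rfl

theorem shift_linSubst {n : ℕ} (g : Matrix (Fin n) (Fin n) K) (v : Fin n → K)
    (f : MvPolynomial (Fin n) K) :
    shift v (linSubst g f) = linSubst g (shift (g.mulVec v) f) := by
  have : (shift v).comp (linSubst g) = (linSubst g).comp (shift (g.mulVec v)) := by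
    ext i : 1
    simp only [AlgHom.comp_apply, linSubst_X, shift_X, map_sum, map_mul, map_add, algHom_C,
      algebraMap_eq, mul_add, Finset.sum_add_distrib, Matrix.mulVec, dotProduct]
  exact DFunLike.congr_fun this f

theorem linSubst_isHomogeneous {n d : ℕ} (g : Matrix (Fin n) (Fin n) K)
    {f : MvPolynomial (Fin n) K} (hf : f.IsHomogeneous d) : (linSubst g f).IsHomogeneous d := by
  rw [← one_mul d]
  refine hf.aeval _ fun i => IsHomogeneous.sum _ _ _ fun j _ => ?_
  exact (isHomogeneous_X K j).C_mul _

theorem linSubst_mem_pow {n k : ℕ} (g : Matrix (Fin n) (Fin n) K)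
    {f : MvPolynomial (Fin n) K} (hf : f ∈ idealOfVars _ K ^ k) :
    linSubst g f ∈ idealOfVars _ K ^ k := by
  refine map_mem_pow_idealOfVars _ (fun i => ?_) hf
  rw [linSubst_X]
  exact Ideal.sum_mem _ fun j _ => Ideal.mul_mem_left _ _ (X_mem_idealOfVars j)

theorem finrank_vanishingForms_mulVec_le {ι : Type*} {n d : ℕ}
    {g h : Matrix (Fin (n + 1)) (Fin (n + 1)) K} (hgh : g * h = 1) (v : ι → Fin (n + 1) → K)
    (m : ι → ℕ) :
    finrank K (vanishingForms n d (fun i => g.mulVec (v i)) m) ≤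
      finrank K (vanishingForms n d v m) := by
  have hinj : Function.Injective (linSubst g).toLinearMap := by
    refine Function.LeftInverse.injective (g := linSubst h) fun f => ?_
    change linSubst h (linSubst g f) = f
    rw [linSubst_linSubst, hgh, linSubst_one]
  rw [(Submodule.equivMapOfInjective _ hinj _).finrank_eq]
  refine Submodule.finrank_mono ?_
  rintro _ ⟨f, hf, rfl⟩
  obtain ⟨h1, h2⟩ := mem_vanishingForms.1 hf
  refine mem_vanishingForms.2 ⟨linSubst_isHomogeneous g h1, fun i => ?_⟩
  change shift (v i) (linSubst g f) ∈ _
  rw [shift_linSubst]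
  exact linSubst_mem_pow g (h2 i)

end Linear

section SimplePoints

theorem Nonspecial.add_simple [Infinite K] {ι : Type*} [Fintype ι] [DecidableEq ι] {n d : ℕ}
    {m : ι → ℕ} (h : Nonspecial K n d m) {u : ι} (hu : m u = 0)
    (hcount : ∑ i, jetDim n (m i) + 1 ≤ (n + d).choose n) :
    Nonspecial K n d (Function.update m u 1) := by
  obtain ⟨v, hv⟩ := h
  have hsum : ∑ i, jetDim n (Function.update m u 1 i) = ∑ i, jetDim n (m i) + 1 := by
    rw [← Finset.add_sum_erase _ _ (Finset.mem_univ u),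
      ← Finset.add_sum_erase _ _ (Finset.mem_univ u), Function.update_self, hu, jetDim_one,
      jetDim_zero, zero_add, add_comm]
    congr 1
    refine Finset.sum_congr rfl fun i hi => ?_
    rw [Function.update_of_ne (Finset.ne_of_mem_erase hi)]
  have hsub : ∀ w, vanishingForms n d (Function.update v u w) (Function.update m u 1) ≤
      vanishingForms n d v m := by
    intro w f hf
    obtain ⟨h1, h2⟩ := mem_vanishingForms.1 hf
    refine mem_vanishingForms.2 ⟨h1, fun i => ?_⟩
    by_cases hi : i = u
    · subst hi
      simp [hu]
    · simpa [hi] using h2 i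
  by_cases hbot : vanishingForms n d v m = ⊥
  · refine ⟨v, ?_⟩
    have h3 := hsub (v u)
    rw [Function.update_eq_self, hbot, le_bot_iff] at h3
    rw [h3, hsum, finrank_bot, zero_add]
    exact hcount
  · obtain ⟨f, hf, hf0⟩ := Submodule.exists_mem_ne_zero_of_ne_bot hbot
    obtain ⟨w, hw⟩ : ∃ w, eval w f ≠ 0 := by
      by_contra hcon
      push Not at hcon
      exact hf0 (MvPolynomial.funext fun x => by rw [hcon, map_zero])
    refine ⟨Function.update v u w, ?_⟩
    have hlt : vanishingForms n d (Function.update v u w) (Function.update m u 1) <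
        vanishingForms n d v m := by
      refine lt_of_le_of_ne (hsub w) fun heq => ?_
      rw [← heq] at hf
      have h4 := (mem_vanishingForms.1 hf).2 u
      rw [Function.update_self, Function.update_self, mem_pow_idealOfVars_iff'] at h4
      have h5 := h4 0 (by simp)
      apply hw
      rw [← constantCoeff_eq] at h5
      rw [← h5]
      have : (eval w : MvPolynomial _ K →+* K) =
          constantCoeff.comp (shift w).toRingHom := by
        ext i
        · simp [shift]
        · simp [shift]
      exact DFunLike.congr_fun this f
    have h6 := Submodule.finrank_lt_finrank_of_lt hlt
    rw [hsum]
    omega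

theorem Nonspecial.add_simples [Infinite K] {ι : Type*} [Fintype ι] {n d : ℕ}
    {m m' : ι → ℕ} (h : Nonspecial K n d m) (hm : ∀ i, m' i = m i ∨ m i = 0 ∧ m' i = 1)
    (hcount : ∑ i, jetDim n (m' i) ≤ (n + d).choose n) : Nonspecial K n d m' := by
  classical
  suffices ∀ s : Finset ι, Nonspecial K n d (fun i => if i ∈ s then m' i else m i) by
    simpa using this Finset.univ
  intro s
  induction s using Finset.induction_on with
  | empty => simpa using h
  | insert u s hu ih =>
    rcases hm u with hmu | ⟨hmu, hmu'⟩
    · convert ih using 2 with i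
      by_cases hi : i = u
      · subst hi
        simp [hu, hmu]
      · simp [hi]
    · have heq : (fun i => if i ∈ insert u s then m' i else m i) =
          Function.update (fun i => if i ∈ s then m' i else m i) u 1 := by
        funext i
        by_cases hi : i = u
        · subst hi
          simp [hmu']
        · simp [hi]
      rw [heq]
      refine ih.add_simple (by simp [hu, hmu]) (le_trans ?_ hcount)
      rw [← Finset.add_sum_erase _ _ (Finset.mem_univ u),
        ← Finset.add_sum_erase Finset.univ (fun i => jetDim n (m' i)) (Finset.mem_univ u), hmu',
        jetDim_one]
      simp only [hu, if_false, hmu, jetDim_zero, zero_add]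
      rw [add_comm]
      refine Nat.add_le_add_left (Finset.sum_le_sum fun i _ => jetDim_mono n ?_) _
      split_ifs
      · exact le_rfl
      · rcases hm i with h1 | ⟨h1, h2⟩ <;> omega

end SimplePoints

section Horace

/-- The square matrix with rows `v j` and the vectors of an indexed frame. -/
def frameMatrix {R ι : Type*} {n : ℕ} (a : Fin n → ι) (v : ι → Fin (n + 1) → R) (j : ι) :
    Matrix (Fin (n + 1)) (Fin (n + 1)) R :=
  Matrix.of (Fin.cons (v j) fun k => v (a k))

theorem frameMatrix_map {R S ι : Type*} [CommRing R] [CommRing S] {n : ℕ} (φ : R →+* S)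
    (a : Fin n → ι) (v : ι → Fin (n + 1) → R) (j : ι) :
    φ (frameMatrix a v j).det = (frameMatrix a (fun i k => φ (v i k)) j).det := by
  rw [RingHom.map_det]
  congr 1
  ext r c
  refine Fin.cases ?_ (fun r => ?_) r <;> simp [frameMatrix]

theorem frameMatrix_mulVec {R ι : Type*} [CommRing R] {n : ℕ}
    (a : Fin n → ι) (v : ι → Fin (n + 1) → R) (j : ι) (g : Matrix (Fin (n + 1)) (Fin (n + 1)) R) :
    frameMatrix a (fun i => g.mulVec (v i)) j = frameMatrix a v j * g.transpose := by
  ext r c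
  refine Fin.cases ?_ (fun r => ?_) r <;>
    simp [frameMatrix, Matrix.mul_apply, Matrix.mulVec, dotProduct, mul_comm]

theorem frame_det_ne_zero {ι : Type*} {n : ℕ} {a : Fin n → ι} (ha : Function.Injective a)
    {j : ι} (hj : ∀ k, a k ≠ j) :
    (frameMatrix a (fun i k => (X (i, k) : MvPolynomial (ι × Fin (n + 1)) K)) j).det ≠ 0 := by
  classical
  intro h0
  let v : ι → Fin (n + 1) → K := fun i =>
    if i = j then Pi.single 0 1 else fun c => if ∃ k, a k = i ∧ c = k.succ then 1 else 0
  have h1 := frameMatrix_map (eval fun x => v x.1 x.2) a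
    (fun i k => (X (i, k) : MvPolynomial (ι × Fin (n + 1)) K)) j
  rw [h0, map_zero] at h1
  have h2 : frameMatrix a (fun i k => eval (fun x => v x.1 x.2)
      (X (i, k) : MvPolynomial (ι × Fin (n + 1)) K)) j = 1 := by
    ext r c
    refine Fin.cases ?_ (fun r => ?_) r
    · simp [frameMatrix, v, Matrix.one_apply, Pi.single_apply, eq_comm]
    · simp only [frameMatrix, Matrix.of_apply, Fin.cons_succ, eval_X, v, hj, if_false,
        Matrix.one_apply]
      congr 1
      rw [eq_iff_iff]
      constructor
      · rintro ⟨k, hk, rfl⟩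
        rw [ha hk]
      · intro h
        exact ⟨r, rfl, h.symm⟩
  rw [h2, Matrix.det_one] at h1
  exact zero_ne_one h1

theorem Nonspecial.of_residual [Infinite K] {ι : Type*} [Fintype ι] [DecidableEq ι] {N d : ℕ}
    {m : ι → ℕ} {A : Finset ι} (hA : A.card = N + 1) {j₀ : ι} (hj₀ : j₀ ∉ A)
    (h1 : ∀ i ∈ A, m i ≤ d + 2) (h2 : ∀ i ∈ A, ∀ j ∈ A, i ≠ j → m i + m j ≤ d + 2)
    (h : Nonspecial K (N + 1) d fun i => if i ∈ A then m i - 1 else m i) :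
    Nonspecial K (N + 1) (d + 1) m := by
  obtain ⟨F, -, hF, hFgen⟩ := exists_genericity_polynomial h
  let e := A.equivFinOfCardEq hA
  let a : Fin (N + 1) → ι := fun k => (e.symm k : ι)
  have ha : Function.Injective a := Subtype.val_injective.comp e.symm.injective
  have haA : ∀ k, a k ∈ A := fun k => (e.symm k).2
  have haj : ∀ j, j ∉ A → ∀ k, a k ≠ j := fun j hj k h => hj (h ▸ haA k)
  have hprod : F * ∏ j ∈ Aᶜ,
      (frameMatrix a (fun i k => (X (i, k) : MvPolynomial (ι × Fin (N + 2)) K)) j).det ≠ 0 := by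
    refine mul_ne_zero hF (Finset.prod_ne_zero_iff.2 fun j hj => ?_)
    exact frame_det_ne_zero ha (haj j (Finset.mem_compl.1 hj))
  obtain ⟨v, hv⟩ := exists_eval_ne_zero hprod
  rw [map_mul, map_prod] at hv
  have hvF := hFgen v (left_ne_zero_of_mul hv)
  have hvD : ∀ j, j ∉ A → (frameMatrix a v j).det ≠ 0 := by
    intro j hj
    have := Finset.prod_ne_zero_iff.1 (right_ne_zero_of_mul hv) j (Finset.mem_compl.2 hj)
    rw [frameMatrix_map] at this
    simpa using this
  let P := (frameMatrix a v j₀).transpose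
  have hP : IsUnit P.det := by
    rw [Matrix.det_transpose]
    exact (hvD j₀ hj₀).isUnit
  let w : ι → Fin (N + 2) → K := fun i => (P⁻¹).mulVec (v i)
  have hwa : ∀ k, w (a k) = Pi.single k.succ 1 := by
    intro k
    have : v (a k) = P.mulVec (Pi.single k.succ 1) := by
      rw [Matrix.mulVec_single_one]
      rfl
    simp only [w, this, Matrix.mulVec_mulVec, Matrix.nonsing_inv_mul _ hP, Matrix.one_mulVec]
  have hwj : ∀ j, j ∉ A → w j 0 ≠ 0 := by
    intro j hj h0
    have hdet : (frameMatrix a w j).det ≠ 0 := by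
      rw [frameMatrix_mulVec, Matrix.det_mul, Matrix.det_transpose]
      exact mul_ne_zero (hvD j hj) (Matrix.isUnit_nonsing_inv_det _ hP).ne_zero
    apply hdet
    refine Matrix.det_eq_zero_of_column_eq_zero 0 fun r => ?_
    refine Fin.cases ?_ (fun r => ?_) r
    · simpa [frameMatrix] using h0
    · simp [frameMatrix, hwa]
  have hae : ∀ i (hi : i ∈ A), a (e ⟨i, hi⟩) = i := fun i hi => by simp [a]
  have hw0 : ∀ i, w i 0 = 0 ↔ i ∈ A := by
    intro i
    by_cases hi : i ∈ A
    · simp only [hi, iff_true]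
      rw [← hae i hi, hwa]
      simp
    · simp only [hi, iff_false]
      exact hwj i hi
  have hres := finrank_vanishingForms_mulVec_le (d := d) (Matrix.nonsing_inv_mul _ hP) v
    (fun i => if i ∈ A then m i - 1 else m i)
  let o : ι → ℕ := fun i => if i ∈ A then m i else 0
  have hhor := finrank_vanishingForms_succ_le (K := K) (N := N) (d := d) (v := w) (m := m) (o := o)
    (m' := fun i => if i ∈ A then m i - 1 else m i)
    (by
      intro f hf i
      by_cases hi : i ∈ A
      · simp only [o, hi, if_true]
        exact trace_of_zero ((hw0 i).2 hi) ((mem_vanishingForms.1 hf).2 i)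
      · simp [o, hi])
    (fun i => by simp only [hw0])
  have htrace : finrank K (vanishingForms N (d + 1) (fun i => Fin.tail (w i)) o) +
      ∑ i, jetDim N (o i) ≤ (N + (d + 1)).choose N := by
    refine finrank_add_le_of_coordinate_points (A := A)
      (e := fun i => if h : i ∈ A then e ⟨i, h⟩ else 0) ?_ ?_ ?_ ?_ ?_
    · intro i hi j hj hij
      rw [Finset.mem_coe] at hi hj
      simp only [hi, hj, dif_pos] at hij
      simpa using hij
    · intro i hi
      simp only [hi, dif_pos]
      conv_lhs => rw [← hae i hi, hwa]
      ext k
      simp [Fin.tail, Pi.single_apply]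
    · intro i hi
      simp [o, hi]
    · intro i
      simp only [o]
      split_ifs with hi
      · exact h1 i hi
      · omega
    · intro i hi j hj hij
      simp only [o, hi, hj, if_true]
      exact h2 i hi j hj hij
  have hpt : ∀ i, jetDim (N + 1) (m i) = jetDim N (o i) +
      jetDim (N + 1) (if i ∈ A then m i - 1 else m i) := by
    intro i
    by_cases hi : i ∈ A
    · simp only [o, hi, if_true]
      rw [jetDim_pascal, add_comm]
    · simp [o, hi, jetDim_zero]
  refine ⟨w, ?_⟩
  rw [Finset.sum_congr rfl fun i _ => hpt i, Finset.sum_add_distrib,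
    show N + 1 + (d + 1) = N + (d + 1) + 1 by ring, Nat.choose_succ_succ',
    show N + (d + 1) = N + 1 + d by ring]
  rw [show N + (d + 1) = N + 1 + d by ring] at htrace
  have : finrank K (vanishingForms (N + 1) d w fun i => if i ∈ A then m i - 1 else m i) ≤
    finrank K (vanishingForms (N + 1) d v fun i => if i ∈ A then m i - 1 else m i) := hres
  omega

/-- A system whose layers are nonspecial is nonspecial. -/
theorem Nonspecial.of_layers [Infinite K] {ι : Type*} [Fintype ι] [DecidableEq ι] {N d : ℕ}
    (i₀ : ι) (B : Finset ι) (hB : i₀ ∉ B) (t : ι → ℕ) (h0 : 1 ≤ t i₀)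
    (hT : ∀ i, i ≠ i₀ → t i₀ + t i ≤ d + 1) (hd : t i₀ ≤ d + 1)
    (hlayer : ∀ k l, l + k = d → t i₀ ≤ l → Nonspecial K N l (layerMult i₀ B k l t)) :
    Nonspecial K (N + 1) d t := by
  obtain ⟨μ, hμ⟩ : ∃ μ, t i₀ = μ + 1 := ⟨t i₀ - 1, by omega⟩
  obtain ⟨k, rfl⟩ : ∃ k, d = μ + k := ⟨d - μ, by omega⟩
  have hex : ∀ j ∈ Finset.range k, ∃ F : MvPolynomial (ι × Fin (N + 1)) K, F ≠ 0 ∧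
      ∀ v : ι → Fin (N + 1) → K, eval (fun x => v x.1 x.2) F ≠ 0 →
        finrank K (vanishingForms N (μ + k - j) v (layerMult i₀ B j (μ + k - j) t)) +
          ∑ i, jetDim N (layerMult i₀ B j (μ + k - j) t i) ≤ (N + (μ + k - j)).choose N := by
    intro j hj
    rw [Finset.mem_range] at hj
    obtain ⟨F, -, hF⟩ := exists_genericity_polynomial
      (hlayer j (μ + k - j) (by omega) (by omega))
    exact ⟨F, hF⟩
  choose! F hF hFgen using hex
  obtain ⟨q, hq⟩ := exists_eval_ne_zero (Finset.prod_ne_zero_iff.2 hF)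
  rw [map_prod, Finset.prod_ne_zero_iff] at hq
  refine ⟨coneVectors i₀ B q, ?_⟩
  have := layering i₀ B hB q μ k t hμ (fun i hi _ => by have := hT i hi; omega)
    (fun j l hl hl' => by
      obtain rfl : l = μ + k - j := by omega
      have hj : j ∈ Finset.range k := Finset.mem_range.2 (by omega)
      exact hFgen j hj q (hq j hj))
  refine this.trans (le_of_eq ?_)
  rw [Nat.add_eq_left]
  refine Finset.sum_eq_zero fun i _ => ?_
  split_ifs with hi
  · have : i ≠ i₀ := fun h => hB (h ▸ hi)
    have := hT i this
    rw [show t i - k = 0 by omega, jetDim_zero]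
  · rfl

end Horace

section FewPoints

/-- Fat points at coordinate vectors are nonspecial as soon as no line obstructs them. -/
theorem Nonspecial.of_card_support_le {ι : Type*} [Fintype ι] {n d : ℕ} {m : ι → ℕ}
    (hcard : (Finset.univ.filter fun i => m i ≠ 0).card ≤ n + 1) (h1 : ∀ i, m i ≤ d + 1)
    (h2 : ∀ i j, i ≠ j → m i + m j ≤ d + 1) : Nonspecial K n d m := by
  classical
  obtain ⟨g, hg⟩ : Nonempty ((Finset.univ.filter fun i => m i ≠ 0) ↪ Fin (n + 1)) :=
    Function.Embedding.nonempty_of_card_le (by simpa only [Fintype.card_coe, Fintype.card_fin] using hcard)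
  let e : ι → Fin (n + 1) := fun i =>
    if h : i ∈ Finset.univ.filter fun i => m i ≠ 0 then g ⟨i, h⟩ else 0
  refine ⟨fun i => Pi.single (e i) 1, finrank_add_le_of_coordinate_points
    (A := Finset.univ.filter fun i => m i ≠ 0) (e := e) ?_ (fun _ _ => rfl) ?_ h1
    fun i _ j _ hij => h2 i j hij⟩
  · intro i hi j hj hij
    rw [Finset.mem_coe] at hi hj
    simp only [e, hi, hj, dif_pos] at hij
    simpa using hg hij
  · intro i hi
    simpa using hi

/-- Fat points of the projective line are nonspecial in degrees at least their total degree
minus one. -/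
theorem nonspecial_line [Infinite K] {ι : Type*} [Fintype ι] {d : ℕ} {m : ι → ℕ}
    (hsum : ∑ i, m i ≤ d + 1) : Nonspecial K 1 d m := by
  classical
  induction d generalizing m with
  | zero =>
    have hpair : ∀ i j, i ≠ j → m i + m j ≤ ∑ i, m i := fun i j hij => by
      rw [← Finset.sum_pair hij]
      exact Finset.sum_le_sum_of_subset (Finset.subset_univ _)
    refine Nonspecial.of_card_support_le ?_
      (fun i => (Finset.single_le_sum (fun _ _ => Nat.zero_le _) (Finset.mem_univ i)).trans hsum)
      fun i j hij => (hpair i j hij).trans hsum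
    by_contra! hcon
    obtain ⟨i, hi, j, hj, hij⟩ := Finset.one_lt_card.1 (by omega : 1 < (Finset.univ.filter fun i => m i ≠ 0).card)
    have := hpair i j hij
    simp only [Finset.mem_filter, Finset.mem_univ, true_and] at hi hj
    omega
  | succ d ih =>
    have hpair : ∀ i j, i ≠ j → m i + m j ≤ ∑ i, m i := fun i j hij => by
      rw [← Finset.sum_pair hij]
      exact Finset.sum_le_sum_of_subset (Finset.subset_univ _)
    have hone : ∀ i, m i ≤ ∑ i, m i := fun i =>
      Finset.single_le_sum (fun _ _ => Nat.zero_le _) (Finset.mem_univ i)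
    by_cases hcard : (Finset.univ.filter fun i => m i ≠ 0).card ≤ 1 + 1
    · exact Nonspecial.of_card_support_le hcard (fun i => (hone i).trans hsum)
        fun i j hij => (hpair i j hij).trans hsum
    obtain ⟨i, hi, j, hj, hij⟩ := Finset.one_lt_card.1 (by omega : 1 < (Finset.univ.filter fun i => m i ≠ 0).card)
    simp only [Finset.mem_filter, Finset.mem_univ, true_and] at hi hj
    refine Nonspecial.of_residual (A := {i}) (j₀ := j) (Finset.card_singleton i)
      (by simpa using hij.symm) (fun k _ => (hone k).trans hsum)
      (fun k _ l _ hkl => (hpair k l hkl).trans hsum) (ih ?_)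
    have hlt : ∑ k, (if k ∈ ({i} : Finset ι) then m k - 1 else m k) < ∑ k, m k := by
      refine Finset.sum_lt_sum (fun k _ => ?_) ⟨i, Finset.mem_univ i, ?_⟩
      · split_ifs <;> omega
      · simp only [Finset.mem_singleton, if_true]
        omega
    omega

end FewPoints

section Admissible

theorem mul_succ_le_choose {N d : ℕ} (hd : 2 ≤ d) : N * (d + 1) ≤ (N + d).choose N := by
  induction d, hd using Nat.le_induction with
  | base =>
    rw [Nat.choose_symm_add, Nat.choose_two_right, Nat.le_div_iff_mul_le two_pos]
    rcases N with _ | N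
    · simp
    rcases N with _ | N
    · simp
    rw [show N + 1 + 1 + 2 - 1 = N + 3 by omega]
    nlinarith
  | succ d hd ih =>
    rcases N with _ | N
    · simp
    rw [show N + 1 + (d + 1) = (N + 1 + d) + 1 by ring, Nat.choose_succ_succ']
    have : N + 1 ≤ (N + 1 + d).choose N := by
      calc N + 1 = (N + 1).choose N := (Nat.choose_succ_self_right N).symm
        _ ≤ _ := Nat.choose_le_choose _ (by omega)
    nlinarith

theorem jetDim_two (n : ℕ) : jetDim n 2 = n + 1 := by
  rw [jetDim_succ, Nat.choose_succ_self_right]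

theorem sq_add_le_choose_three {n : ℕ} (hn : 3 ≤ n) : n ^ 2 + 4 * n - 1 ≤ (n + 3).choose n := by
  induction n, hn using Nat.le_induction with
  | base => decide
  | succ n hn ih =>
    have h : (n + 1 + 3).choose (n + 1) = (n + 3).choose n + (n + 3).choose (n + 1) := by
      rw [show n + 1 + 3 = n + 3 + 1 by ring, Nat.choose_succ_succ']
    have h2 := mul_succ_le_choose (N := n + 1) (d := 2) le_rfl
    rw [show n + 1 + 2 = n + 3 by ring] at h2
    have h3 : (n + 1) ^ 2 = n ^ 2 + 2 * n + 1 := by ring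
    omega

theorem jetDim_lt_succ {n : ℕ} (hn : 1 ≤ n) (m : ℕ) : jetDim n m < jetDim n (m + 1) := by
  obtain ⟨n, rfl⟩ : ∃ k, n = k + 1 := ⟨n - 1, by omega⟩
  have := jetDim_pascal n (m + 1)
  have h2 : 0 < jetDim n (m + 1) := by
    rw [jetDim_succ]
    exact Nat.choose_pos (by omega)
  simp only [Nat.add_sub_cancel] at this
  omega

/-- The differences of `jetDim` in codimension at least two are strictly increasing. -/
theorem jetDim_add_lt_add {n : ℕ} (hn : 2 ≤ n) {a b : ℕ} (hab : b ≤ a) :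
    jetDim n a + jetDim n b < jetDim n (a + 1) + jetDim n (b - 1) := by
  obtain ⟨n, rfl⟩ : ∃ k, n = k + 1 := ⟨n - 1, by omega⟩
  have h1 := jetDim_pascal n (a + 1)
  have h2 := jetDim_pascal n b
  have h3 : jetDim n b < jetDim n (a + 1) :=
    (jetDim_mono n hab).trans_lt (jetDim_lt_succ (by omega) a)
  simp only [Nat.add_sub_cancel] at h1
  omega

/-- The numerical conditions on multiplicities and degree under which the general fat point
scheme is shown to be nonspecial. -/
structure Admissible {ι : Type*} [Fintype ι] (n d : ℕ) (m : ι → ℕ) : Prop where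
  pair : ∀ i j, i ≠ j → m i + m j ≤ d + 1
  le : ∀ i, m i ≤ d
  excess : ∑ i, (m i - 1) + 2 ≤ n * (d - 1) ∨ (Finset.univ.filter fun i => 2 ≤ m i).card ≤ n
  total : ∑ i, m i ≤ n * (d + 1)
  top : ∀ i, m i = d → ∑ i, m i + 1 ≤ n * (d + 1)

theorem nonspecial_of_simple_rest [Infinite K] {ι : Type*} [Fintype ι] {n d : ℕ} {m : ι → ℕ}
    (A : Finset ι) (hA : A.card ≤ n + 1) (hm : ∀ i, i ∉ A → m i ≤ 1) (h1 : ∀ i ∈ A, m i ≤ d + 1)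
    (h2 : ∀ i j, i ≠ j → m i + m j ≤ d + 1)
    (hcount : ∑ i, jetDim n (m i) ≤ (n + d).choose n) : Nonspecial K n d m := by
  classical
  have h : Nonspecial K n d fun i => if i ∈ A then m i else 0 := by
    refine Nonspecial.of_card_support_le ((Finset.card_le_card fun i hi => ?_).trans hA)
      (fun i => ?_) fun i j hij => ?_
    · by_contra hiA
      simp [hiA] at hi
    · split_ifs with hi
      · exact h1 i hi
      · omega
    · have := h2 i j hij
      split_ifs <;> omega
  refine h.add_simples (fun i => ?_) hcount
  by_cases hi : i ∈ A
  · simp [hi]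
  · have := hm i hi
    rcases Nat.le_one_iff_eq_zero_or_eq_one.1 this with h0 | h0 <;> simp [hi, h0]

theorem jetDim_le_self {m : ℕ} (n : ℕ) (hm : m ≤ 1) : jetDim n m = m := by
  rcases m with _ | _ | m
  · rfl
  · exact jetDim_one n
  · omega

theorem Admissible.nonspecial_of_top [Infinite K] {ι : Type*} [Fintype ι] {n d : ℕ}
    {m : ι → ℕ} (hn : 1 ≤ n) (hd : 2 ≤ d) (h : Admissible n d m) {i₀ : ι} (hi₀ : m i₀ = d) :
    Nonspecial K n d m := by
  classical
  have hm : ∀ i, i ≠ i₀ → m i ≤ 1 := fun i hi => by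
    have := h.pair i i₀ hi
    omega
  refine nonspecial_of_simple_rest {i₀} (by simp) (by simpa using hm)
    (by simp [hi₀]) h.pair ?_
  have htop := h.top i₀ hi₀
  obtain ⟨N, rfl⟩ : ∃ N, n = N + 1 := ⟨n - 1, by omega⟩
  obtain ⟨e, rfl⟩ : ∃ e, d = e + 1 := ⟨d - 1, by omega⟩
  rw [← Finset.add_sum_erase _ _ (Finset.mem_univ i₀)] at htop ⊢
  have hrest : ∑ i ∈ Finset.univ.erase i₀, jetDim (N + 1) (m i) =
      ∑ i ∈ Finset.univ.erase i₀, m i :=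
    Finset.sum_congr rfl fun i hi => jetDim_le_self (N + 1) (hm i (Finset.ne_of_mem_erase hi))
  rw [hrest, hi₀, jetDim_succ, show N + 1 + (e + 1) = (N + 1 + e) + 1 by ring, Nat.choose_succ_succ']
  rw [hi₀] at htop
  have := mul_succ_le_choose (N := N) hd
  rw [show N + (e + 1) = N + 1 + e by ring] at this
  have h3 : (N + 1) * (e + 1 + 1) = N * (e + 1 + 1) + (e + 1 + 1) := by ring
  omega

theorem nonspecial_of_simple [Infinite K] {ι : Type*} [Fintype ι] {n : ℕ} {m : ι → ℕ}
    (hm : ∀ i, m i ≤ 1) (hsum : ∑ i, m i ≤ n * (2 + 1)) : Nonspecial K n 2 m := by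
  refine nonspecial_of_simple_rest ∅ (by simp) (fun i _ => hm i) (by simp)
    (fun i j _ => by have := hm i; have := hm j; omega) ?_
  rw [Finset.sum_congr rfl fun i _ => jetDim_le_self n (hm i)]
  exact hsum.trans (mul_succ_le_choose le_rfl)

theorem Admissible.nonspecial_of_doubles [Infinite K] {ι : Type*} [Fintype ι] {n : ℕ}
    {m : ι → ℕ} (h : Admissible n 3 m) (hm : ∀ i, m i ≤ 2)
    (hcard : (Finset.univ.filter fun i => 2 ≤ m i).card = n + 1) : Nonspecial K n 3 m := by
  have hexc := h.excess.resolve_right (by omega)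
  have htot := h.total
  have hsum1 : ∑ i, (m i - 1) = n + 1 := by
    rw [← hcard, Finset.card_filter]
    refine Finset.sum_congr rfl fun i _ => ?_
    have := hm i
    split_ifs <;> omega
  have hsum2 : ∑ i, jetDim n (m i) + (n + 1) = ∑ i, m i + n * (n + 1) := by
    have hi : ∀ i, jetDim n (m i) + (m i - 1) = m i + n * (m i - 1) := fun i => by
      have := hm i
      interval_cases m i
      · simp [jetDim_zero]
      · simp [jetDim_one]
      · simp [jetDim_two]
        ring
    rw [← hsum1, ← Finset.sum_add_distrib, Finset.sum_congr rfl fun i _ => hi i,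
      Finset.sum_add_distrib, ← Finset.mul_sum]
  refine nonspecial_of_simple_rest _ hcard.le (fun i hi => ?_) (fun i _ => (hm i).trans (by omega))
    h.pair ?_
  · simp only [Finset.mem_filter, Finset.mem_univ, true_and, not_le] at hi
    omega
  · have := sq_add_le_choose_three (n := n) (by omega)
    have h3 : n * (n + 1) = n ^ 2 + n := by ring
    omega

/-- A finite family of natural numbers has a set of largest members of each size. -/
theorem exists_largest {ι : Type*} [Fintype ι] (m : ι → ℕ) (k : ℕ) (hk : k ≤ Fintype.card ι) :
    ∃ A : Finset ι, A.card = k ∧ ∀ i ∈ A, ∀ j, j ∉ A → m j ≤ m i := by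
  classical
  induction k with
  | zero => exact ⟨∅, by simp⟩
  | succ k ih =>
    obtain ⟨A, hA, hmax⟩ := ih (by omega)
    have hne : (Aᶜ).Nonempty := by
      rw [← Finset.card_pos, Finset.card_compl]
      omega
    obtain ⟨x, hx, hxmax⟩ := Finset.exists_max_image Aᶜ m hne
    rw [Finset.mem_compl] at hx
    refine ⟨insert x A, by rw [Finset.card_insert_of_notMem hx, hA], fun i hi j hj => ?_⟩
    rw [Finset.mem_insert, not_or] at hj
    rcases Finset.mem_insert.1 hi with rfl | hi
    · exact hxmax j (Finset.mem_compl.2 hj.2)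
    · exact hmax i hi j hj.2

end Admissible

section Induction

theorem sum_residual {ι : Type*} [Fintype ι] [DecidableEq ι] {A : Finset ι} {m : ι → ℕ}
    (hpos : ∀ i ∈ A, 1 ≤ m i) :
    ∑ i, (if i ∈ A then m i - 1 else m i) + A.card = ∑ i, m i := by
  have : A.card = ∑ i, if i ∈ A then 1 else 0 := by simp
  rw [this, ← Finset.sum_add_distrib]
  refine Finset.sum_congr rfl fun i _ => ?_
  split_ifs with hi
  · have := hpos i hi
    omega
  · rfl

theorem Admissible.residual {ι : Type*} [Fintype ι] [DecidableEq ι] {n d : ℕ} {m : ι → ℕ}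
    {A : Finset ι} (h : Admissible n (d + 1) m) (hn : 1 ≤ n) (hd : 2 ≤ d) (hA : A.card = n)
    (hpos : ∀ i ∈ A, 1 ≤ m i) (hmax : ∀ i ∈ A, ∀ j, j ∉ A → m j ≤ m i) (hlt : ∀ i, m i ≤ d)
    (hne : ∀ i j, i ∉ A → j ∉ A → i ≠ j → m i + m j ≠ d + 2)
    (hdoub : d = 2 → (Finset.univ.filter fun i => 2 ≤ m i).card ≠ n + 1) :
    Admissible n d fun i => if i ∈ A then m i - 1 else m i := by
  obtain ⟨a, ha⟩ : A.Nonempty := Finset.card_pos.1 (by omega)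
  have hsum := sum_residual hpos
  have htot := h.total
  have hmul : n * (d + 1 + 1) = n * (d + 1) + n := by ring
  refine ⟨fun i j hij => ?_, fun i => ?_, ?_, by omega, fun i hi => ?_⟩
  · have h1 := h.pair i j hij
    by_cases hi : i ∈ A <;> by_cases hj : j ∈ A <;> simp only [hi, hj, if_true, if_false]
    · have := hpos i hi
      omega
    · have := hpos i hi
      omega
    · have := hpos j hj
      omega
    · have := hne i j hi hj hij
      omega
  · have := hlt i
    split_ifs <;> omega
  · by_cases hcard : (Finset.univ.filter fun i => 2 ≤ m i).card ≤ n
    · right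
      refine (Finset.card_le_card fun i hi => ?_).trans hcard
      simp only [Finset.mem_filter, Finset.mem_univ, true_and] at hi ⊢
      split_ifs at hi <;> omega
    · left
      have hexc := h.excess.resolve_right hcard
      have h2 : ∀ i ∈ A, 1 ≤ m i - 1 := by
        intro i hi
        by_contra hlt2
        refine hcard ((Finset.card_le_card fun j hj => ?_).trans hA.le)
        by_contra hjA
        have := hmax i hi j hjA
        simp only [Finset.mem_filter, Finset.mem_univ, true_and] at hj
        omega
      have hsum2 := sum_residual h2
      have hcongr : ∀ i, (if i ∈ A then m i - 1 else m i) - 1 =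
          if i ∈ A then m i - 1 - 1 else m i - 1 := fun i => by split_ifs <;> rfl
      simp only [hcongr]
      obtain ⟨e, rfl⟩ : ∃ e, d = e + 1 := ⟨d - 1, by omega⟩
      simp only [Nat.add_sub_cancel] at hexc ⊢
      have : n * (e + 1) = n * e + n := by ring
      omega
  · exfalso
    by_cases hiA : i ∈ A
    · simp only [hiA, if_true] at hi
      have := hlt i
      have := hpos i hiA
      omega
    · simp only [hiA, if_false] at hi
      have hai : a ≠ i := fun h => hiA (h ▸ ha)
      have h1 := h.pair a i hai
      have h2 := hmax a ha i hiA
      obtain rfl : d = 2 := by omega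
      have hsub : insert i A ⊆ Finset.univ.filter fun i => 2 ≤ m i := by
        intro j hj
        simp only [Finset.mem_filter, Finset.mem_univ, true_and]
        rcases Finset.mem_insert.1 hj with rfl | hj
        · exact hi.ge
        · exact hi.ge.trans (hmax j hj i hiA)
      have hins : (insert i A).card = n + 1 := by rw [Finset.card_insert_of_notMem hiA, hA]
      obtain ⟨j, hj, hji⟩ := Finset.exists_of_ssubset
        (hsub.ssubset_of_ne fun heq => hdoub rfl (heq ▸ hins))
      rw [Finset.mem_insert, not_or] at hji
      simp only [Finset.mem_filter, Finset.mem_univ, true_and] at hj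
      have := hlt j
      exact hne i j hiA hji.2 (Ne.symm hji.1) (by omega)

/-- Admissibility of a layer in the extremal case, where at least `N + 3` points have the largest
multiplicity `k + j + 1` and the degree is `2 * (k + j) + 1`. -/
theorem admissible_layer {ι : Type*} [Fintype ι] [DecidableEq ι] {N k j : ℕ} {t o : ι → ℕ}
    {i₀ b u : ι} (hN : 2 ≤ N) (hkj : 1 ≤ k + j) (hb : b ≠ i₀)
    (ht0 : t i₀ = k + j + 1) (htb : t b = k + j + 1) (hle : ∀ i, t i ≤ k + j + 1)
    (hcard : N + 3 ≤ ∑ i, if t i = k + j + 1 then 1 else 0)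
    (hexc : ∑ i, (t i - 1) + 2 ≤ (N + 1) * (2 * (k + j)))
    (htot : ∑ i, t i ≤ (N + 1) * (2 * (k + j) + 2))
    (ho0 : o i₀ = 0) (hob : o b = k + 1)
    (ho : ∀ i, i ≠ i₀ → i ≠ b → o i = t i - k ∨ i = u ∧ t i = 1 ∧ o i ≤ 1)
    (hslack : ∑ i, t i + 1 ≤ (N + 1) * (2 * (k + j) + 2) ∨
      ∃ x, t x < k + j + 1 ∧ o x + 1 ≤ t x) :
    Admissible N (k + 2 * j + 1) o := by
  set r := ∑ i, if t i = k + j + 1 then 1 else 0 with hr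
  have hbound : ∀ i, i ≠ b → o i ≤ j + 1 := by
    intro i hib
    by_cases hi0 : i = i₀
    · subst hi0
      omega
    · have := hle i
      rcases ho i hi0 hib with h | h <;> omega
  have hr2 : r * (k + j) + 2 ≤ (N + 1) * (2 * (k + j)) := by
    refine le_trans (Nat.add_le_add_right ?_ 2) hexc
    rw [hr, Finset.sum_mul]
    refine Finset.sum_le_sum fun i _ => ?_
    split_ifs <;> omega
  have hr3 : r ≤ 2 * N + 1 := by
    by_contra! hcon
    have := Nat.mul_le_mul_right (k + j) hcon
    nlinarith
  have hone : ∀ (i₁ : ι) (c : ℕ), ∑ i, (if i = i₁ then c else 0) = c := fun i₁ c => by simp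
  have hrk : ∑ i, (if t i = k + j + 1 then k else 0) = r * k := by
    rw [hr, Finset.sum_mul]
    refine Finset.sum_congr rfl fun i _ => ?_
    split_ifs <;> simp
  have hrN : (N + 3) * k ≤ r * k := Nat.mul_le_mul_right k hcard
  have hpt : ∀ i, o i + (if t i = k + j + 1 then k else 0) + (if i = i₀ then k + j + 1 else 0) +
      (if i = b then k + j + 1 else 0) ≤
      t i + (if i = i₀ then k else 0) + (if i = b then 2 * k + 1 else 0) := by
    intro i
    by_cases hi0 : i = i₀
    · subst hi0
      simp only [hb.symm, ht0, ho0, if_true, if_false]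
      omega
    by_cases hib : i = b
    · subst hib
      simp only [hb, htb, hob, if_true, if_false]
      omega
    have := hle i
    simp only [hi0, hib, if_false]
    rcases ho i hi0 hib with h | h <;> split_ifs <;> omega
  refine ⟨fun x y hxy => ?_, fun i => ?_, Or.inl ?_, ?_, fun i hi => ?_⟩
  · by_cases hx : x = b
    · subst hx
      have := hbound y hxy.symm
      omega
    · have h1 := hbound x hx
      by_cases hy : y = b
      · subst hy
        omega
      · have := hbound y hy
        omega
  · by_cases hi : i = b
    · subst hi
      omega
    · have := hbound i hi
      omega
  · have : ∀ i, (o i - 1) + (if t i = k + j + 1 then k else 0) + (if i = i₀ then k + j else 0) +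
        (if i = b then k + j else 0) ≤
        (t i - 1) + (if i = i₀ then k else 0) + (if i = b then 2 * k else 0) := by
      intro i
      by_cases hi0 : i = i₀
      · subst hi0
        simp only [hb.symm, ht0, ho0, if_true, if_false]
        omega
      by_cases hib : i = b
      · subst hib
        simp only [hb, htb, hob, if_true, if_false]
        omega
      have := hle i
      simp only [hi0, hib, if_false]
      rcases ho i hi0 hib with h | h <;> split_ifs <;> omega
    have := Finset.sum_le_sum fun i (_ : i ∈ Finset.univ) => this i
    simp only [Finset.sum_add_distrib, hone, hrk] at this
    rw [show k + 2 * j + 1 - 1 = k + 2 * j by omega]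
    nlinarith
  · rcases hslack with h | ⟨x, hx1, hx2⟩
    · have := Finset.sum_le_sum fun i (_ : i ∈ Finset.univ) => hpt i
      simp only [Finset.sum_add_distrib, hone, hrk] at this
      nlinarith
    · have hxi : x ≠ i₀ := by
        rintro rfl
        omega
      have hxb : x ≠ b := by
        rintro rfl
        omega
      have := Finset.sum_lt_sum (fun i (_ : i ∈ Finset.univ) => hpt i)
        ⟨x, Finset.mem_univ x, by simp only [hx1.ne, hxi, hxb, if_false]; omega⟩
      simp only [Finset.sum_add_distrib, hone, hrk] at this
      nlinarith
  · have hib : i = b := by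
      by_contra hib
      have := hbound i hib
      by_cases hi0 : i = i₀
      · subst hi0
        omega
      · have := hle i
        rcases ho i hi0 hib with h | h <;> omega
    subst hib
    obtain rfl : j = 0 := by omega
    have : ∀ x, o x + (if x = i₀ then 1 else 0) ≤ (if t x = k + 0 + 1 then 1 else 0) +
        (if x = u then 1 else 0) + (if x = i then k else 0) := by
      intro x
      by_cases hx0 : x = i₀
      · subst hx0
        simp only [ht0, ho0, if_true]
        omega
      by_cases hxi : x = i
      · subst hxi
        simp only [htb, hob, hx0, if_true, if_false]
        omega
      have := hle x
      simp only [hx0, hxi, if_false]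
      rcases ho x hx0 hxi with h | h
      · split_ifs <;> omega
      · simp only [h.1, if_true] at h ⊢
        omega
    have := Finset.sum_le_sum fun i (_ : i ∈ Finset.univ) => this i
    simp only [Finset.sum_add_distrib, hone] at this
    rw [← hr] at this
    have hgoal : r + 1 + k ≤ N * (k + 2 * 0 + 1 + 1) := by
      rcases Nat.lt_or_ge N 3 with hN3 | hN3
      · obtain rfl : N = 2 := by omega
        have hr5 : r = 5 := by omega
        rw [hr5] at hr2 ⊢
        omega
      · nlinarith
    omega

end Induction

section Extremal

theorem card_max_le {ι : Type*} [Fintype ι] {N ν : ℕ} {t : ι → ℕ} (hν : 1 ≤ ν)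
    (hexc : ∑ i, (t i - 1) + 2 ≤ (N + 1) * (2 * ν)) :
    ∑ i, (if t i = ν + 1 then 1 else 0) ≤ 2 * N + 1 := by
  have hr2 : (∑ i, if t i = ν + 1 then 1 else 0) * ν ≤ ∑ i, (t i - 1) := by
    rw [Finset.sum_mul]
    refine Finset.sum_le_sum fun i _ => ?_
    split_ifs <;> omega
  by_contra! hcon
  have := Nat.mul_le_mul_right ν hcon
  nlinarith

theorem admissible_of_le_half {ι : Type*} [Fintype ι] {N ν : ℕ} {t : ι → ℕ} (hν : 1 ≤ ν)
    (hle : ∀ i, t i ≤ ν + 1) (hexc : ∑ i, (t i - 1) + 2 ≤ N * (2 * ν))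
    (htot : ∑ i, t i ≤ N * (2 * ν + 2)) : Admissible N (2 * ν + 1) t where
  pair i j _ := by
    have := hle i
    have := hle j
    omega
  le i := by
    have := hle i
    omega
  excess := Or.inl hexc
  total := htot
  top i hi := by
    have := hle i
    omega

/-- In the tight extremal case without simple points, the zeroth layer is nonspecial. -/
theorem nonspecial_bottom_layer [Infinite K] {ι : Type*} [Fintype ι] [DecidableEq ι] {N ν : ℕ}
    {t : ι → ℕ} {i₀ b x y : ι} (hN : 2 ≤ N) (hν : 1 ≤ ν) (hb : b ≠ i₀)
    (ht0 : t i₀ = ν + 1) (htb : t b = ν + 1) (hle : ∀ i, t i ≤ ν + 1)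
    (hexc : ∑ i, (t i - 1) + 2 ≤ (N + 1) * (2 * ν))
    (htot : ∑ i, t i ≤ (N + 1) * (2 * ν + 2))
    (hxy : x ≠ y) (hx : t x < ν + 1) (hy : 2 ≤ t y) (hyx : t y ≤ t x)
    (hind : ∀ o : ι → ℕ, Admissible N (2 * ν + 1) o → Nonspecial K N (2 * ν + 1) o) :
    Nonspecial K N (2 * ν + 1)
      (Function.update (fun i => if i = i₀ ∨ i = b then 0 else t i) b 1) := by
  set T : ι → ℕ := fun i => if i = i₀ ∨ i = b then 0 else t i with hT
  let T' : ι → ℕ := fun i => if i = x then t x + 1 else if i = y then t y - 1 else T i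
  have hone : ∀ (i₁ : ι) (c : ℕ), ∑ i, (if i = i₁ then c else 0) = c := fun i₁ c => by simp
  have hTx : T x = t x := by
    refine if_neg ?_
    rintro (rfl | rfl) <;> omega
  have hTy : T y = t y := by
    refine if_neg ?_
    rintro (rfl | rfl) <;> omega
  have hsplit : ∀ g : ℕ → ℕ, g 0 = 0 → ∑ i, g (T i) + 2 * g (ν + 1) = ∑ i, g (t i) := by
    intro g hg
    have : ∀ i, g (T i) + (if i = i₀ then g (ν + 1) else 0) + (if i = b then g (ν + 1) else 0) =
        g (t i) := by
      intro i
      by_cases hi0 : i = i₀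
      · subst hi0
        simp [hT, hb.symm, hg, ht0]
      by_cases hib : i = b
      · subst hib
        simp [hT, hb, hg, htb]
      simp [hT, hi0, hib]
    rw [← Finset.sum_congr rfl fun i _ => this i]
    simp only [Finset.sum_add_distrib, hone]
    ring
  have hswap : ∀ g : ℕ → ℕ, ∑ i, g (T' i) + g (t y) + g (t x) =
      ∑ i, g (T i) + g (t y - 1) + g (t x + 1) := by
    intro g
    have : ∀ i, g (T' i) + (if i = y then g (t y) else 0) + (if i = x then g (t x) else 0) =
        g (T i) + (if i = y then g (t y - 1) else 0) + (if i = x then g (t x + 1) else 0) := by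
      intro i
      by_cases hix : i = x
      · subst hix
        simp [T', hxy, hTx, add_comm]
      by_cases hiy : i = y
      · subst hiy
        simp [T', hix, hTy, add_comm]
      simp [T', hix, hiy]
    have := Finset.sum_congr rfl fun i (_ : i ∈ Finset.univ) => this i
    simpa only [Finset.sum_add_distrib, hone] using this
  have h1 := hsplit (fun k => k) rfl
  have h2 := hsplit (fun k => k - 1) rfl
  have h3 := hswap (fun k => k)
  have h4 := hswap (fun k => k - 1)
  have h5 := hswap (jetDim N)
  have hmul1 : (N + 1) * (2 * ν) = N * (2 * ν) + 2 * ν := by ring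
  have hmul2 : (N + 1) * (2 * ν + 2) = N * (2 * ν + 2) + (2 * ν + 2) := by ring
  have hTle : ∀ i, T i ≤ ν + 1 := fun i => by
    have := hle i
    simp only [hT]
    split_ifs <;> omega
  have hTn : Nonspecial K N (2 * ν + 1) T :=
    hind T (admissible_of_le_half hν hTle (by omega) (by omega))
  obtain ⟨v, hv⟩ := hind T' (admissible_of_le_half hν (fun i => by
    have := hTle i
    simp only [T']
    split_ifs <;> omega) (by omega) (by omega))
  have h6 := jetDim_add_lt_add hN hyx
  exact hTn.add_simple (by simp [hT]) (by omega)

theorem nonspecial_extremal [Infinite K] {ι : Type*} [Fintype ι] {N ν : ℕ} {t : ι → ℕ}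
    (hN : 2 ≤ N) (hν : 1 ≤ ν) (hle : ∀ i, t i ≤ ν + 1)
    (hcard : N + 3 ≤ ∑ i, if t i = ν + 1 then 1 else 0)
    (hexc : ∑ i, (t i - 1) + 2 ≤ (N + 1) * (2 * ν))
    (htot : ∑ i, t i ≤ (N + 1) * (2 * ν + 2))
    (hind : ∀ l, 2 ≤ l → ∀ o : ι → ℕ, Admissible N l o → Nonspecial K N l o) :
    Nonspecial K (N + 1) (2 * ν + 1) t := by
  classical
  obtain ⟨i₀, hi₀, b, hb, hne⟩ : ∃ i₀, t i₀ = ν + 1 ∧ ∃ b, t b = ν + 1 ∧ b ≠ i₀ := by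
    rw [← Finset.card_filter] at hcard
    obtain ⟨a, ha, b, hb, hab⟩ := Finset.one_lt_card.1
      (by omega : 1 < (Finset.univ.filter fun i => t i = ν + 1).card)
    simp only [Finset.mem_filter, Finset.mem_univ, true_and] at ha hb
    exact ⟨a, ha, b, hb, hab.symm⟩
  have hpair : ∀ i, i ≠ i₀ → t i₀ + t i ≤ 2 * ν + 1 + 1 := fun i _ => by
    have := hle i
    omega
  have key : ∀ (B : Finset ι) (u : ι), i₀ ∉ B → b ∈ B →
      (∀ i ∈ B, i = b ∨ i = u ∧ t i = 1) → ∀ k j, k + j = ν →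
      (∑ i, t i + 1 ≤ (N + 1) * (2 * ν + 2) ∨
        ∃ x, t x < ν + 1 ∧ layerMult i₀ B k (k + 2 * j + 1) t x + 1 ≤ t x) →
      Nonspecial K N (k + 2 * j + 1) (layerMult i₀ B k (k + 2 * j + 1) t) := by
    rintro B u hB hbB hu k j rfl hslack
    refine hind _ (by omega) _ (admissible_layer (u := u) hN hν hne hi₀ hb hle hcard hexc htot
      (by simp [layerMult]) ?_ (fun i h0 hib => ?_) hslack)
    · simp only [layerMult, hne, hbB, if_true, if_false]
      omega
    · simp only [layerMult, h0, if_false]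
      split_ifs with hiB
      · right
        obtain ⟨h1, h2⟩ := (hu i hiB).resolve_left hib
        exact ⟨h1, h2, by omega⟩
      · exact Or.inl rfl
  by_cases htight : ∑ i, t i + 1 ≤ (N + 1) * (2 * ν + 2)
  · refine Nonspecial.of_layers i₀ {b} (by simpa using hne.symm) t (by omega) hpair (by omega)
      fun k l hkl hl => ?_
    obtain ⟨j, rfl⟩ : ∃ j, ν = k + j := ⟨ν - k, by omega⟩
    obtain rfl : l = k + 2 * j + 1 := by omega
    exact key {b} b (by simpa using hne.symm) (by simp) (by simp) k j rfl (Or.inl htight)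
  have hr := card_max_le hν hexc
  have hQ : 1 < (Finset.univ.filter fun i => 0 < t i ∧ t i < ν + 1).card := by
    by_contra! hQ
    have hpt : ∀ i, t i ≤ (if t i = ν + 1 then 1 else 0) * (ν + 1) +
        (if 0 < t i ∧ t i < ν + 1 then 1 else 0) * ν := fun i => by
      have := hle i
      split_ifs <;> omega
    have := Finset.sum_le_sum fun i (_ : i ∈ Finset.univ) => hpt i
    rw [Finset.sum_add_distrib, ← Finset.sum_mul, ← Finset.sum_mul,
      ← Finset.card_filter (fun i => 0 < t i ∧ t i < ν + 1)] at this
    nlinarith [Nat.mul_le_mul_right (ν + 1) hr, Nat.mul_le_mul_right ν hQ]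
  obtain ⟨x, hx, y, hy, hxy⟩ := Finset.one_lt_card.1 hQ
  simp only [Finset.mem_filter, Finset.mem_univ, true_and] at hx hy
  wlog hyx : t y ≤ t x generalizing x y
  · exact this y x hxy.symm hy hx (by omega)
  have hx0 : ∀ z, t z < ν + 1 → z ≠ i₀ ∧ z ≠ b := fun z hz =>
    ⟨by rintro rfl; omega, by rintro rfl; omega⟩
  obtain ⟨hxi, hxb⟩ := hx0 x hx.2
  by_cases hu : ∃ u, t u = 1
  · obtain ⟨u, hu⟩ := hu
    obtain ⟨hui, hub⟩ := hx0 u (by omega)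
    have hB : i₀ ∉ ({b, u} : Finset ι) := by simp [hne.symm, hui.symm]
    refine Nonspecial.of_layers i₀ {b, u} hB t (by omega) hpair (by omega) fun k l hkl hl => ?_
    obtain ⟨j, rfl⟩ : ∃ j, ν = k + j := ⟨ν - k, by omega⟩
    obtain rfl : l = k + 2 * j + 1 := by omega
    refine key {b, u} u hB (by simp) (fun i hi => ?_) k j rfl (Or.inr ?_)
    · rcases Finset.mem_insert.1 hi with h | h
      · exact Or.inl h
      · rw [Finset.mem_singleton.1 h]
        exact Or.inr ⟨rfl, hu⟩
    · rcases Nat.eq_zero_or_pos k with rfl | hk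
      · refine ⟨u, by omega, ?_⟩
        simp only [layerMult, hui, Finset.mem_insert, Finset.mem_singleton, or_true, if_true,
          if_false]
        omega
      · obtain ⟨z, hz, hzu⟩ : ∃ z, (0 < t z ∧ t z < k + j + 1) ∧ z ≠ u := by
          by_cases hxu : x = u
          · exact ⟨y, hy, fun h => hxy (hxu.trans h.symm)⟩
          · exact ⟨x, hx, hxu⟩
        obtain ⟨hzi, hzb⟩ := hx0 z hz.2
        refine ⟨z, hz.2, ?_⟩
        simp only [layerMult, hzi, hzb, hzu, Finset.mem_insert, Finset.mem_singleton, or_self,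
          if_false]
        omega
  · have hB : i₀ ∉ ({b} : Finset ι) := by simpa using hne.symm
    refine Nonspecial.of_layers i₀ {b} hB t (by omega) hpair (by omega) fun k l hkl hl => ?_
    rcases Nat.eq_zero_or_pos k with rfl | hk
    · obtain rfl : l = 2 * ν + 1 := by omega
      have hy2 : 2 ≤ t y := by
        by_contra hlt
        exact hu ⟨y, by omega⟩
      convert nonspecial_bottom_layer (K := K) hN hν hne hi₀ hb hle hexc htot hxy hx.2 hy2 hyx
        (hind (2 * ν + 1) (by omega)) using 1
      funext i
      by_cases hib : i = b
      · subst hib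
        simp only [layerMult, hne, Finset.mem_singleton, Function.update_self, if_true, if_false]
        omega
      · by_cases hi0 : i = i₀
        · subst hi0
          simp [layerMult, hib]
        · simp [layerMult, hib, hi0]
    · obtain ⟨j, rfl⟩ : ∃ j, ν = k + j := ⟨ν - k, by omega⟩
      obtain rfl : l = k + 2 * j + 1 := by omega
      refine key {b} b hB (by simp) (by simp) k j rfl (Or.inr ⟨x, hx.2, ?_⟩)
      simp only [layerMult, hxi, hxb, Finset.mem_singleton, if_false]
      omega

end Extremal

section Main

/-- Two equal complements to the largest `n` multiplicities spanning an extremal line force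
many points of the same largest multiplicity. -/
theorem Admissible.eq_max {ι : Type*} [Fintype ι] [DecidableEq ι] {n d : ℕ} {m : ι → ℕ}
    {A : Finset ι} (h : Admissible n d m) (hA : A.Nonempty)
    (hmax : ∀ i ∈ A, ∀ j, j ∉ A → m j ≤ m i) {i j : ι} (hi : i ∉ A) (hj : j ∉ A) (hij : i ≠ j)
    (heq : m i + m j = d + 1) :
    ∃ ν, d = 2 * ν + 1 ∧ (∀ x, m x ≤ ν + 1) ∧
      A.card + 2 ≤ ∑ x, if m x = ν + 1 then 1 else 0 := by
  have hall : ∀ a ∈ A, m a = m i ∧ m a = m j := by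
    intro a ha
    have h1 := h.pair a i fun h => hi (h ▸ ha)
    have h2 := h.pair a j fun h => hj (h ▸ ha)
    have h3 := hmax a ha i hi
    have h4 := hmax a ha j hj
    omega
  obtain ⟨a, ha⟩ := hA
  have hij' := hall a ha
  have hmi : m i = (d / 2) + 1 := by omega
  refine ⟨d / 2, by omega, fun x => ?_, ?_⟩
  · by_cases hx : x ∈ A
    · have := hall x hx
      omega
    · have := hmax a ha x hx
      omega
  · rw [← Finset.card_filter]
    have hcard : (insert i (insert j A)).card = A.card + 2 := by
      rw [Finset.card_insert_of_notMem (by simp [hij, hi]), Finset.card_insert_of_notMem hj]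
    rw [← hcard]
    refine Finset.card_le_card fun x hx => ?_
    simp only [Finset.mem_filter, Finset.mem_univ, true_and]
    simp only [Finset.mem_insert] at hx
    rcases hx with rfl | rfl | hx
    · exact hmi
    · omega
    · have := hall x hx
      omega

/-- Admissible multiplicities are nonspecial. -/
theorem Admissible.nonspecial [Infinite K] {ι : Type*} [Fintype ι] {n d : ℕ} {m : ι → ℕ}
    (hn : 2 ≤ n) (hd : 2 ≤ d) (h : Admissible n d m) : Nonspecial K n d m := by
  classical
  induction n using Nat.strong_induction_on generalizing d m with
  | _ n ihn =>
  induction d, hd using Nat.le_induction generalizing m with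
  | base =>
    by_cases htop : ∃ i, m i = 2
    · obtain ⟨i, hi⟩ := htop
      exact h.nonspecial_of_top (by omega) le_rfl hi
    · push Not at htop
      exact nonspecial_of_simple (fun i => by have := h.le i; have := htop i; omega) h.total
  | succ d hd ihd =>
    by_cases htop : ∃ i, m i = d + 1
    · obtain ⟨i, hi⟩ := htop
      exact h.nonspecial_of_top (by omega) (by omega) hi
    push Not at htop
    have hlt : ∀ i, m i ≤ d := fun i => by have := h.le i; have := htop i; omega
    by_cases hsupp : (Finset.univ.filter fun i => m i ≠ 0).card ≤ n + 1
    · exact Nonspecial.of_card_support_le hsupp (fun i => (hlt i).trans (by omega)) h.pair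
    by_cases hdoub : d = 2 ∧ (Finset.univ.filter fun i => 2 ≤ m i).card = n + 1
    · obtain ⟨rfl, hdoub⟩ := hdoub
      exact h.nonspecial_of_doubles hlt hdoub
    obtain ⟨A, hA, hmax⟩ := exists_largest m n (by
      have := Finset.card_le_univ (Finset.univ.filter fun i => m i ≠ 0)
      omega)
    have hpos : ∀ i ∈ A, 1 ≤ m i := by
      intro i hi
      obtain ⟨j, hj, hjA⟩ := Finset.exists_mem_notMem_of_card_lt_card
        (by omega : A.card < (Finset.univ.filter fun i => m i ≠ 0).card)
      simp only [Finset.mem_filter, Finset.mem_univ, true_and] at hj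
      have := hmax i hi j hjA
      omega
    obtain ⟨N, rfl⟩ : ∃ N, n = N + 1 := ⟨n - 1, by omega⟩
    by_cases hne : ∀ i j, i ∉ A → j ∉ A → i ≠ j → m i + m j ≠ d + 2
    · obtain ⟨j₀, hj₀⟩ : ∃ j, j ∉ A := by
        by_contra! hcon
        have := Finset.card_le_card (fun i _ => hcon i :
          (Finset.univ.filter fun i => m i ≠ 0) ⊆ A)
        omega
      exact Nonspecial.of_residual hA hj₀ (fun i _ => (hlt i).trans (by omega))
        (fun i _ j _ hij => h.pair i j hij)
        (ihd (h.residual (by omega) hd hA hpos hmax hlt hne fun h2 h3 => hdoub ⟨h2, h3⟩))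
    · push Not at hne
      obtain ⟨i, j, hi, hj, hij, heq⟩ := hne
      obtain ⟨ν, hν, hle, hcard⟩ := h.eq_max (Finset.card_pos.1 (by omega)) hmax hi hj hij heq
      rw [hA] at hcard
      obtain rfl : d = 2 * ν := by omega
      have hexc : ∑ i, (m i - 1) + 2 ≤ (N + 1) * (2 * ν) := by
        refine h.excess.resolve_right fun hcon => ?_
        have : (Finset.univ.filter fun i => m i = ν + 1).card ≤
            (Finset.univ.filter fun i => 2 ≤ m i).card := by
          refine Finset.card_le_card fun x hx => ?_
          simp only [Finset.mem_filter, Finset.mem_univ, true_and] at hx ⊢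
          omega
        rw [← Finset.card_filter] at hcard
        omega
      have hr := card_max_le (by omega) hexc
      exact nonspecial_extremal (by omega) (by omega) hle hcard hexc h.total
        fun l hl o ho => ihn N (by omega) (by omega) hl ho

/-- The numerical hypotheses of the theorem imply nonspeciality at suitable points. -/
theorem nonspecial_of_sum_le [Infinite K] {n s d : ℕ}
    (hn : 1 ≤ n) (hs : n + 3 ≤ s) (hd : 2 ≤ d)
    (m : Fin s → ℕ) (hm : ∀ i, 1 ≤ m i) (hmd : ∀ i, m i ≤ d)
    (hpair : ∀ i j, i ≠ j → m i + m j ≤ d + 1)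
    (hsum : ((∑ i, m i : ℕ) : ℤ) ≤ (n : ℤ) * d +
      min ((n : ℤ) - (Finset.univ.filter fun i => m i = d).card) ((s : ℤ) - n - 2)) :
    Nonspecial K n d m := by
  have h3 : ∑ i, (m i - 1) + s = ∑ i, m i := by
    have : ∑ i, (m i - 1) + ∑ _i : Fin s, 1 = ∑ i, m i := by
      rw [← Finset.sum_add_distrib]
      exact Finset.sum_congr rfl fun i _ => Nat.sub_add_cancel (hm i)
    simpa using this
  have hcard : ∀ i, m i = d → 1 ≤ (Finset.univ.filter fun i => m i = d).card := fun i hi =>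
    Finset.card_pos.2 ⟨i, by simpa using hi⟩
  have h1 : ∑ i, m i + (Finset.univ.filter fun i => m i = d).card ≤ n * d + n := by
    have := hsum.trans (add_le_add_right (min_le_left _ _) _)
    generalize ∑ i, m i = S at *
    generalize (Finset.univ.filter fun i => m i = d).card = c at *
    zify
    linarith
  have h2 : ∑ i, m i + n + 2 ≤ n * d + s := by
    have := hsum.trans (add_le_add_right (min_le_right _ _) _)
    generalize ∑ i, m i = S at *
    zify
    linarith
  rcases Nat.lt_or_ge 1 n with hn2 | hn2
  · obtain ⟨e, rfl⟩ : ∃ e, d = e + 1 := ⟨d - 1, by omega⟩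
    have h4 : n * (e + 1) = n * e + n := by ring
    have h5 : n * (e + 1 + 1) = n * (e + 1) + n := by ring
    refine Admissible.nonspecial hn2 hd
      ⟨hpair, hmd, Or.inl ?_, by omega, fun i hi => by have := hcard i hi; omega⟩
    rw [Nat.add_sub_cancel]
    omega
  · obtain rfl : n = 1 := by omega
    exact nonspecial_line (by omega)

end Main

section Hilbert

theorem ker_quotient_mkₐ {σ : Type*} (I : Ideal (MvPolynomial σ K)) :
    LinearMap.ker (Ideal.Quotient.mkₐ K I).toLinearMap = I.restrictScalars K := by
  ext f
  simp [Ideal.Quotient.eq_zero_iff_mem]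

theorem hilbDim_add {n : ℕ} (I : Ideal (MvPolynomial (Fin (n + 1)) K)) (d : ℕ) :
    hilbDim I d + finrank K (homogeneousSubmodule (Fin (n + 1)) K d ⊓
      I.restrictScalars K : Submodule K (MvPolynomial (Fin (n + 1)) K)) = (n + d).choose n := by
  have := finrank_le_map_add (Ideal.Quotient.mkₐ K I).toLinearMap
    (homogeneousSubmodule (Fin (n + 1)) K d)
  rw [ker_quotient_mkₐ, finrank_homogeneousSubmodule] at this
  exact this.symm

theorem shift_mem_of_mem_pointIdeal {n k : ℕ} {p : Projectivization K (Fin (n + 1) → K)}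
    {f : MvPolynomial (Fin (n + 1)) K} (hf : f ∈ pointIdeal p ^ k) :
    shift p.rep f ∈ idealOfVars (Fin (n + 1)) K ^ k := by
  have h1 : Ideal.map (shift p.rep) (pointIdeal p) ≤ idealOfVars (Fin (n + 1)) K := by
    rw [pointIdeal, Ideal.map_span, Ideal.span_le]
    rintro _ ⟨_, ⟨c, hc, rfl⟩, rfl⟩
    have : shift p.rep (∑ i, C (c i) * X i) = ∑ i, C (c i) * X i := by
      simp only [map_sum, map_mul, shift_X, algHom_C, algebraMap_eq, mul_add,
        Finset.sum_add_distrib]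
      rw [add_eq_left]
      simp only [← map_mul, ← map_sum, hc, map_zero]
    rw [this]
    exact Ideal.sum_mem _ fun i _ => Ideal.mul_mem_left _ _ (X_mem_idealOfVars i)
  have h2 := Ideal.mem_map_of_mem (shift p.rep) hf
  rw [Ideal.map_pow] at h2
  exact Ideal.pow_right_mono h1 k h2

theorem le_hilbDim_fatIdeal {n s d : ℕ} {p : Fin s → Projectivization K (Fin (n + 1) → K)}
    {m : Fin s → ℕ}
    (h : finrank K (vanishingForms n d (fun i => (p i).rep) m) + ∑ i, jetDim n (m i) ≤
      (n + d).choose n) : ∑ i, jetDim n (m i) ≤ hilbDim (fatIdeal p m) d := by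
  have h1 := hilbDim_add (fatIdeal p m) d
  have h2 : finrank K (homogeneousSubmodule (Fin (n + 1)) K d ⊓
      (fatIdeal p m).restrictScalars K : Submodule K (MvPolynomial (Fin (n + 1)) K)) ≤
      finrank K (vanishingForms n d (fun i => (p i).rep) m) := by
    refine Submodule.finrank_mono fun f hf => mem_vanishingForms.2 ⟨hf.1, fun i => ?_⟩
    have h3 : f ∈ fatIdeal p m := hf.2
    exact shift_mem_of_mem_pointIdeal ((Ideal.mem_iInf.1 h3) i)
  omega

/-- A nonzero vector is sent to a coordinate vector by an invertible matrix. -/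
theorem exists_mulVec_eq_single {n : ℕ} {v : Fin n → K} (hv : v ≠ 0) :
    ∃ (j : Fin n) (g h : Matrix (Fin n) (Fin n) K), g * h = 1 ∧ g.mulVec v = Pi.single j 1 := by
  obtain ⟨j, hj⟩ := Function.ne_iff.1 hv
  let P := (1 : Matrix (Fin n) (Fin n) K).updateCol j v
  have hP : IsUnit P.det := by
    rw [← Matrix.cramer_apply, Matrix.cramer_one]
    exact IsUnit.mk0 _ hj
  have hPv : P.mulVec (Pi.single j 1) = v := by
    rw [Matrix.mulVec_single_one]
    ext i
    simp [P]
  refine ⟨j, P⁻¹, P, Matrix.nonsing_inv_mul _ hP, ?_⟩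
  rw [← hPv, Matrix.mulVec_mulVec, Matrix.nonsing_inv_mul _ hP, Matrix.one_mulVec]

theorem linSubst_mem_pointIdeal {n d k : ℕ} {p : Projectivization K (Fin (n + 1) → K)}
    {j : Fin (n + 1)} {g : Matrix (Fin (n + 1)) (Fin (n + 1)) K}
    (hg : g.mulVec p.rep = Pi.single j 1) {f : MvPolynomial (Fin (n + 1)) K}
    (hf : f.IsHomogeneous d) (hk : ∀ u ∈ f.support, u j + k ≤ d) :
    linSubst g f ∈ pointIdeal p ^ k := by
  have hX : ∀ i, i ≠ j → linSubst g (X i) ∈ pointIdeal p := by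
    intro i hi
    refine Ideal.subset_span ⟨g i, ?_, linSubst_X g i⟩
    have := congrFun hg i
    rw [Pi.single_eq_of_ne hi] at this
    exact this
  rw [f.as_sum, map_sum]
  refine Ideal.sum_mem _ fun u hu => ?_
  have hdeg : u.degree = d := isHomogeneous_iff.1 hf u (mem_support_iff.1 hu)
  rw [Finsupp.degree_eq_sum, ← Finset.add_sum_erase _ _ (Finset.mem_univ j)] at hdeg
  have huk := hk u hu
  rw [monomial_eq_prod, map_mul, map_prod,
    ← Finset.mul_prod_erase _ _ (Finset.mem_univ j)]
  refine Ideal.mul_mem_left _ _ (Ideal.mul_mem_left _ _ ?_)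
  refine Ideal.pow_le_pow_right (by omega : k ≤ ∑ i ∈ Finset.univ.erase j, u i) ?_
  rw [← Finset.prod_pow_eq_pow_sum]
  refine Ideal.prod_mem_prod fun i hi => ?_
  rw [map_pow]
  exact Ideal.pow_mem_pow (hX i (Finset.ne_of_mem_erase hi)) _

theorem hilbDim_pointIdeal_le {n d k : ℕ} (p : Projectivization K (Fin (n + 1) → K))
    (hk : k ≤ d + 1) : hilbDim (pointIdeal p ^ k) d ≤ jetDim n k := by
  obtain ⟨j, g, h, hgh, hg⟩ := exists_mulVec_eq_single p.rep_nonzero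
  set S : Finset (Fin (n + 1) →₀ ℕ) := Finset.univ.finsuppAntidiag d with hS
  have hcard := Finset.card_filter_add_card_filter_not (s := S) (fun u => d < u j + k)
  rw [hS, card_filter_antidiag n d k hk j, Finset.card_finsuppAntidiag_nat_eq_choose] at hcard
  simp only [Finset.card_univ, Fintype.card_fin] at hcard
  rw [show n + 1 + d - 1 = n + d by omega, ← Nat.choose_symm_add] at hcard
  set S' := (Finset.univ.finsuppAntidiag d : Finset (Fin (n + 1) →₀ ℕ)).filter
    fun u => ¬ d < u j + k
  have hle : (restrictSupport K (S' : Set (Fin (n + 1) →₀ ℕ))).map (linSubst g).toLinearMap ≤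
      homogeneousSubmodule (Fin (n + 1)) K d ⊓ (pointIdeal p ^ k).restrictScalars K := by
    rintro _ ⟨f, hf, rfl⟩
    have hf' : f.support ⊆ S' := by
      rw [SetLike.mem_coe, mem_restrictSupport_iff] at hf
      exact_mod_cast hf
    have hhom : f.IsHomogeneous d :=
      mem_homogeneousSubmodule_iff.2 (hf'.trans (Finset.filter_subset _ _))
    refine ⟨linSubst_isHomogeneous g hhom, linSubst_mem_pointIdeal hg hhom fun u hu => ?_⟩
    have := (Finset.mem_filter.1 (hf' hu)).2
    omega
  have hinj : Function.Injective (linSubst g).toLinearMap := by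
    refine Function.LeftInverse.injective (g := linSubst h) fun f => ?_
    change linSubst h (linSubst g f) = f
    rw [linSubst_linSubst, hgh, linSubst_one]
  have hfin : Module.Finite K (homogeneousSubmodule (Fin (n + 1)) K d ⊓
      (pointIdeal p ^ k).restrictScalars K : Submodule K (MvPolynomial (Fin (n + 1)) K)) :=
    Submodule.finiteDimensional_of_le inf_le_left
  have h1 := Submodule.finrank_mono hle
  rw [← (Submodule.equivMapOfInjective _ hinj _).finrank_eq, (finrank_supported S').1] at h1
  have h2 := hilbDim_add (pointIdeal p ^ k) d
  omega

theorem hilbDim_iInf_le {n s : ℕ} (I : Fin s → Ideal (MvPolynomial (Fin (n + 1)) K)) (d : ℕ) :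
    hilbDim (⨅ i, I i) d ≤ ∑ i, hilbDim (I i) d := by
  let V := homogeneousSubmodule (Fin (n + 1)) K d
  have key : ∀ A : Finset (Fin s), (n + d).choose n ≤
      finrank K (V ⊓ A.inf fun i => (I i).restrictScalars K :
        Submodule K (MvPolynomial (Fin (n + 1)) K)) + ∑ i ∈ A, hilbDim (I i) d := by
    intro A
    induction A using Finset.induction_on with
    | empty =>
      rw [Finset.inf_empty, inf_top_eq, Finset.sum_empty, add_zero]
      exact (finrank_homogeneousSubmodule n d).ge
    | insert i A hi ih =>
      have hfin : Module.Finite K (V ⊓ A.inf fun i => (I i).restrictScalars K :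
          Submodule K (MvPolynomial (Fin (n + 1)) K)) :=
        Submodule.finiteDimensional_of_le inf_le_left
      rw [finrank_le_map_add (Ideal.Quotient.mkₐ K (I i)).toLinearMap] at ih
      rw [Finset.sum_insert hi, Finset.inf_insert]
      have h1 : finrank K ((V ⊓ A.inf fun i => (I i).restrictScalars K).map
          (Ideal.Quotient.mkₐ K (I i)).toLinearMap) ≤ hilbDim (I i) d :=
        Submodule.finrank_mono (Submodule.map_mono inf_le_left)
      have h2 : (V ⊓ A.inf fun i => (I i).restrictScalars K) ⊓
          LinearMap.ker (Ideal.Quotient.mkₐ K (I i)).toLinearMap =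
          V ⊓ ((I i).restrictScalars K ⊓ A.inf fun i => (I i).restrictScalars K) := by
        rw [ker_quotient_mkₐ, inf_assoc, inf_comm (A.inf _)]
      rw [h2] at ih
      omega
  have h1 := key Finset.univ
  have h2 : hilbDim (⨅ i, I i) d + finrank K (V ⊓ (⨅ i, I i).restrictScalars K :
      Submodule K (MvPolynomial (Fin (n + 1)) K)) = _ := hilbDim_add _ _
  have h3 : (Finset.univ.inf fun i => (I i).restrictScalars K) =
      (⨅ i, I i).restrictScalars K := by
    ext f
    simp [Finset.inf_univ_eq_iInf]
  rw [h3] at h1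
  omega

theorem h1Zero_of_finrank_le {n s d : ℕ} {p : Fin s → Projectivization K (Fin (n + 1) → K)}
    {m : Fin s → ℕ} (hm : ∀ i, 1 ≤ m i) (hmd : ∀ i, m i ≤ d)
    (h : finrank K (vanishingForms n d (fun i => (p i).rep) m) + ∑ i, jetDim n (m i) ≤
      (n + d).choose n) : H1Zero p m d := by
  have hexp : expDeg n m = ∑ i, jetDim n (m i) :=
    Finset.sum_congr rfl fun i _ => (if_neg (by have := hm i; omega)).symm
  rw [H1Zero, hexp]
  exact le_antisymm ((hilbDim_iInf_le _ d).trans (Finset.sum_le_sum fun i _ =>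
    hilbDim_pointIdeal_le (p i) ((hmd i).trans (Nat.le_succ d)))) (le_hilbDim_fatIdeal h)

end Hilbert

section Multihomogeneous

theorem multiHomog_of_isWeightedHomogeneous {s n : ℕ} {f : MvPolynomial (Fin s × Fin (n + 1)) K}
    {w : Fin s → ℕ} (hf : IsWeightedHomogeneous (blockWeight (Fin s) (Fin (n + 1))) f w) :
    MultiHomog f := by
  refine ⟨w, fun u hu i => ?_⟩
  rw [← hf (mem_support_iff.1 hu), Finsupp.weight_apply, Finsupp.sum_fintype _ _ (by simp),
    Finset.sum_apply, Fintype.sum_prod_type]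
  simp [blockWeight, Pi.single_apply, Finset.sum_ite_eq]

theorem eval_smul_of_multiHomog {s n : ℕ} {f : MvPolynomial (Fin s × Fin (n + 1)) K}
    (hf : MultiHomog f) (v : Fin s → Fin (n + 1) → K) {c : Fin s → K} (hc : ∀ i, c i ≠ 0)
    (h : eval (fun x => v x.1 x.2) f ≠ 0) : eval (fun x => c x.1 * v x.1 x.2) f ≠ 0 := by
  obtain ⟨w, hw⟩ := hf
  have : eval (fun x => c x.1 * v x.1 x.2) f =
      (∏ i, c i ^ w i) * eval (fun x => v x.1 x.2) f := by
    rw [eval_eq', eval_eq', Finset.mul_sum]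
    refine Finset.sum_congr rfl fun u hu => ?_
    have h1 : ∏ x : Fin s × Fin (n + 1), c x.1 ^ u x = ∏ i, c i ^ w i := by
      rw [Fintype.prod_prod_type]
      refine Finset.prod_congr rfl fun i _ => ?_
      rw [← hw u hu i]
      exact Finset.prod_pow_eq_pow_sum Finset.univ (fun y => u (i, y)) (c i)
    simp only [mul_pow, Finset.prod_mul_distrib]
    rw [h1]
    ring
  rw [this]
  exact mul_ne_zero (Finset.prod_ne_zero_iff.2 fun i _ => pow_ne_zero _ (hc i)) h

/-- The minor detecting proportionality of the coordinates `a` and `b` of a pair of vectors. -/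
noncomputable def pairMinor (K : Type*) [Field K] {s n : ℕ} (a b : Fin (n + 1))
    (x : Fin s × Fin s) : MvPolynomial (Fin s × Fin (n + 1)) K :=
  X (x.1, a) * X (x.2, b) - X (x.1, b) * X (x.2, a)

theorem pairMinor_isWeightedHomogeneous {s n : ℕ} (a b : Fin (n + 1)) (x : Fin s × Fin s) :
    IsWeightedHomogeneous (blockWeight (Fin s) (Fin (n + 1))) (pairMinor K a b x)
      (Pi.single x.1 1 + Pi.single x.2 1) := by
  rw [pairMinor, sub_eq_add_neg]
  exact ((isWeightedHomogeneous_X _ _ _).mul (isWeightedHomogeneous_X _ _ _)).add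
    ((isWeightedHomogeneous_X _ _ _).mul (isWeightedHomogeneous_X _ _ _)).neg

theorem pairMinor_ne_zero {s n : ℕ} {a b : Fin (n + 1)} (hab : a ≠ b) {x : Fin s × Fin s}
    (hx : x.1 ≠ x.2) : pairMinor K a b x ≠ 0 := by
  intro h0
  have := congrArg (eval fun y : Fin s × Fin (n + 1) =>
    if y = (x.1, a) ∨ y = (x.2, b) then (1 : K) else 0) h0
  simp [pairMinor, hab, hab.symm, hx, hx.symm] at this

end Multihomogeneous

open Classical in
/-- **Corollary `bound for non-special`** (after Brambilla–Dumitrescu–Postinghel).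
Let `n ≥ 1`, `s ≥ n + 3`, `d ≥ 2`, `d ≥ m₁ ≥ ⋯ ≥ m_s ≥ 1`, let `s(d)` be the number of
multiplicities equal to `d` and `b = min{n − s(d), s − n − 2}` (an integer, possibly
negative).  If `Σ m_i ≤ nd + b` and `d ≥ m₁ + m₂ − 1`, then for `s` points of `ℙⁿ` in
general position (all tuples in a nonempty basic Zariski-open subset of `(ℙⁿ)ˢ`) the points
are distinct and the fat point scheme `Z = Σ m_i p_i` satisfies `h¹(I_Z(d)) = 0`. -/
theorem bdp_nonspecial {K : Type*} [Field K] [IsAlgClosed K] {n s d : ℕ}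
    (hn : 1 ≤ n) (hs : n + 3 ≤ s) (hd : 2 ≤ d)
    (m : Fin s → ℕ) (hm : ∀ i, 1 ≤ m i) (hmd : ∀ i, m i ≤ d)
    (hsort : ∀ i j : Fin s, i ≤ j → m j ≤ m i)
    (hsum : ((∑ i, m i : ℕ) : ℤ) ≤ (n : ℤ) * d +
      min ((n : ℤ) - (Finset.univ.filter fun i => m i = d).card) ((s : ℤ) - n - 2))
    (hline : m ⟨0, by omega⟩ + m ⟨1, by omega⟩ - 1 ≤ d) :
    ∃ f : MvPolynomial (Fin s × Fin (n + 1)) K, MultiHomog f ∧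
      (∃ p : Fin s → Projectivization K (Fin (n + 1) → K), evalAtReps p f ≠ 0) ∧
      ∀ p : Fin s → Projectivization K (Fin (n + 1) → K), evalAtReps p f ≠ 0 →
        Function.Injective p ∧ H1Zero p m d := by
  classical
  have hpair : ∀ i j, i ≠ j → m i + m j ≤ d + 1 := by
    intro i j hij
    have h0 : ∀ k, m k ≤ m ⟨0, by omega⟩ := fun k => hsort _ _ (Fin.mk_le_of_le_val k.val.zero_le)
    have h1 : ∀ k : Fin s, (k : ℕ) ≠ 0 → m k ≤ m ⟨1, by omega⟩ := fun k hk =>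
      hsort _ _ (Fin.mk_le_of_le_val (Nat.one_le_iff_ne_zero.2 hk))
    have h0i := h0 i
    have h0j := h0 j
    by_cases hi : (i : ℕ) = 0
    · have := h1 j fun hj => hij (Fin.ext (hi.trans hj.symm))
      omega
    · have := h1 i hi
      omega
  obtain ⟨F, ⟨w, hFw⟩, hF0, hF⟩ := exists_genericity_polynomial
    (nonspecial_of_sum_le (K := K) hn hs hd m hm hmd hpair hsum)
  have hab : (0 : Fin (n + 1)) ≠ Fin.last n := by
    rw [Ne, Fin.ext_iff, Fin.val_zero, Fin.val_last]
    omega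
  let Q : Finset (Fin s × Fin s) := Finset.univ.offDiag
  have hQ : ∀ {i j : Fin s}, i ≠ j → (i, j) ∈ Q := fun h => by simpa [Q] using h
  let f := F * ∏ x ∈ Q, pairMinor K 0 (Fin.last n) x
  have hf : MultiHomog f := multiHomog_of_isWeightedHomogeneous
    (hFw.mul (IsWeightedHomogeneous.prod _ _ _ fun x _ =>
      pairMinor_isWeightedHomogeneous 0 (Fin.last n) x))
  have hf0 : f ≠ 0 := mul_ne_zero hF0 (Finset.prod_ne_zero_iff.2 fun x hx =>
    pairMinor_ne_zero hab (Finset.mem_offDiag.1 hx).2.2)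
  have hminor : ∀ {v : Fin s → Fin (n + 1) → K}, eval (fun x => v x.1 x.2) f ≠ 0 →
      ∀ {i j}, i ≠ j → v i 0 * v j (Fin.last n) - v i (Fin.last n) * v j 0 ≠ 0 := by
    intro v hv i j hij
    rw [map_mul, map_prod] at hv
    simpa [pairMinor] using Finset.prod_ne_zero_iff.1 (right_ne_zero_of_mul hv) (i, j) (hQ hij)
  refine ⟨f, hf, ?_, fun p hp => ⟨fun i j hij => ?_, ?_⟩⟩
  · obtain ⟨v, hv⟩ := exists_eval_ne_zero hf0
    have hv0 : ∀ i, v i ≠ 0 := by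
      intro i hi
      have : Nontrivial (Fin s) := Fin.nontrivial_iff_two_le.2 (by omega)
      obtain ⟨j, hj⟩ := exists_ne i
      exact hminor hv hj.symm (by simp [hi])
    choose c hc using fun i => Projectivization.exists_smul_eq_mk_rep K (v i) (hv0 i)
    refine ⟨fun i => Projectivization.mk K (v i) (hv0 i), ?_⟩
    rw [evalAtReps]
    simp only [← hc]
    exact eval_smul_of_multiHomog hf v (c := fun i => (c i : K)) (fun i => (c i).ne_zero) hv
  · by_contra hne
    exact hminor (v := fun i => (p i).rep) hp hne (by rw [hij, mul_comm, sub_self])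
  · exact h1Zero_of_finrank_le hm hmd (hF _ (left_ne_zero_of_mul (by rwa [← map_mul])))
end

section
/- Let Z = Σ_{i=1}^s m_i p_i be a fat point scheme on distinct points of P^n, let 1 ≤ m ≤ n, let C ⊂ P^n be a rational normal curve of degree m, and let d ≥ 0 be an integer. If w_C(Z) = Σ_{p_i ∈ C} m_i ≥ md + 2, then h^1(I_Z(d)) > 0. -/
open MvPolynomial Module

variable {K : Type*} [Field K]

/-- `C` is a rational normal curve of degree `m` in `ℙⁿ` (`1 ≤ m ≤ n`): the image of the
composite of the degree-`m` Veronese map `ℙ¹ → ℙᵐ`, `[s:t] ↦ [sᵐ : sᵐ⁻¹t : ⋯ : tᵐ]`, with an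
injective projective-linear embedding `ℙᵐ → ℙⁿ`. -/
def IsRNC (n m : ℕ) (C : Set (Projectivization K (Fin (n + 1) → K))) : Prop :=
  ∃ g : (Fin (m + 1) → K) →ₗ[K] (Fin (n + 1) → K), Function.Injective g ∧
    C = {x | ∃ s t : K, (s ≠ 0 ∨ t ≠ 0) ∧
      ∃ h : g (fun j => s ^ (m - (j : ℕ)) * t ^ (j : ℕ)) ≠ 0,
        x = Projectivization.mk K (g (fun j => s ^ (m - (j : ℕ)) * t ^ (j : ℕ))) h}

/-- Linear maps out of `V` whose ranks add up to at most the rank of the combined map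
are jointly surjective onto the product of their ranges. -/
lemma exists_forall_eq_of_sum_finrank_range_le {F V ι : Type*} [Field F] [AddCommGroup V]
    [Module F V] [FiniteDimensional F V] [Fintype ι] {M : ι → Type*} [∀ i, AddCommGroup (M i)]
    [∀ i, Module F (M i)] (T : ∀ i, V →ₗ[F] M i)
    (h : ∑ i, finrank F (LinearMap.range (T i)) ≤ finrank F (LinearMap.range (LinearMap.pi T)))
    (v : ι → V) : ∃ x, ∀ i, T i x = T i (v i) := by
  set S : V →ₗ[F] (∀ i, LinearMap.range (T i)) := LinearMap.pi fun i => (T i).rangeRestrict with hS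
  have hker : LinearMap.ker S = LinearMap.ker (LinearMap.pi T) := by
    simp [hS, LinearMap.ker_pi]
  have hrange : finrank F (LinearMap.range S) = finrank F (LinearMap.range (LinearMap.pi T)) := by
    have h₁ := S.finrank_range_add_finrank_ker
    have h₂ := (LinearMap.pi T).finrank_range_add_finrank_ker
    rw [hker] at h₁
    omega
  have htop : LinearMap.range S = ⊤ := by
    apply Submodule.eq_top_of_finrank_eq
    refine le_antisymm (Submodule.finrank_le _) ?_
    rw [Module.finrank_pi_fintype, hrange]
    exact h
  obtain ⟨x, hx⟩ := LinearMap.range_eq_top.mp htop fun i => (T i).rangeRestrict (v i)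
  refine ⟨x, fun i => ?_⟩
  simpa [hS, Subtype.ext_iff] using congrFun hx i

lemma finrank_range_le_of_ker_le {F V M N : Type*} [Field F] [AddCommGroup V] [Module F V]
    [FiniteDimensional F V] [AddCommGroup M] [Module F M] [AddCommGroup N] [Module F N]
    (f : V →ₗ[F] M) (g : V →ₗ[F] N) (h : LinearMap.ker f ≤ LinearMap.ker g) :
    finrank F (LinearMap.range g) ≤ finrank F (LinearMap.range f) := by
  have h₁ := f.finrank_range_add_finrank_ker
  have h₂ := g.finrank_range_add_finrank_ker
  have h₃ := Submodule.finrank_mono h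
  omega

lemma finrank_range_pi_le {F V ι : Type*} [Field F] [AddCommGroup V]
    [Module F V] [FiniteDimensional F V] [Fintype ι] {M : ι → Type*} [∀ i, AddCommGroup (M i)]
    [∀ i, Module F (M i)] (T : ∀ i, V →ₗ[F] M i) :
    finrank F (LinearMap.range (LinearMap.pi T)) ≤ ∑ i, finrank F (LinearMap.range (T i)) := by
  rw [← Module.finrank_pi_fintype]
  refine (finrank_range_le_of_ker_le (LinearMap.pi fun i => (T i).rangeRestrict) _ ?_).trans
    (Submodule.finrank_le _)
  simp [LinearMap.ker_pi]

lemma finrank_homogeneousSubmodule_fin {F : Type*} [Field F] (n d : ℕ) :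
    finrank F (homogeneousSubmodule (Fin (n + 1)) F d) = (n + d).choose n := by
  classical
  have e : {x : Fin (n + 1) →₀ ℕ | x.degree = d} ≃ Sym (Fin (n + 1)) d :=
    (Equiv.subtypeEquivRight fun _ => Iff.rfl).trans
      (Sym.equivNatSum (Fin (n + 1)) d).symm
  have : Fintype {x : Fin (n + 1) →₀ ℕ | x.degree = d} := Fintype.ofEquiv _ e.symm
  rw [homogeneousSubmodule_eq_finsupp_supported,
    (AddMonoidAlgebra.supportedEquivFinsupp _).finrank_eq,
    Module.finrank_finsupp_self, Fintype.card_congr e, Sym.card_sym_eq_choose, Fintype.card_fin,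
    Nat.choose_symm_of_eq_add (a := d) (b := n) (by omega)]
  congr 1
  omega

instance finiteDimensional_homogeneousSubmodule {F σ : Type*} [Field F] [Finite σ] (d : ℕ) :
    FiniteDimensional F (homogeneousSubmodule σ F d) :=
  Module.Finite.iff_fg.mpr (homogeneousSubmodule_fg σ F d)

/-- If modulo `I` every linear form is a multiple of `ℓ`, then every form of degree `e + 1` is
divisible by `ℓ` modulo `I ^ (e + 1)`. -/
lemma exists_sub_mul_mem_pow {F σ : Type*} [Field F] {I : Ideal (MvPolynomial σ F)}
    {ℓ : MvPolynomial σ F} (hℓ : ℓ.IsHomogeneous 1)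
    (hI : ∀ x : MvPolynomial σ F, x.IsHomogeneous 1 → ∃ c : F, x - C c * ℓ ∈ I) (e : ℕ) :
    ∀ f : MvPolynomial σ F, f.IsHomogeneous (e + 1) →
      ∃ g : MvPolynomial σ F, g.IsHomogeneous e ∧ f - ℓ * g ∈ I ^ (e + 1) := by
  induction e with
  | zero =>
    intro f hf
    obtain ⟨c, hc⟩ := hI f hf
    exact ⟨C c, isHomogeneous_C _ _, by simpa [mul_comm] using hc⟩
  | succ e ih =>
    intro f hf
    rw [← mem_homogeneousSubmodule, ← homogeneousSubmodule_one_pow, pow_succ',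
      homogeneousSubmodule_one_pow] at hf
    induction hf using Submodule.mul_induction_on' with
    | mem_mul_mem x hx f hf =>
      obtain ⟨c, hc⟩ := hI x hx
      obtain ⟨g, hg, hfg⟩ := ih f hf
      have hg' : (ℓ * g).IsHomogeneous (e + 1) := by
        simpa [add_comm] using hℓ.mul hg
      refine ⟨x * g + C c * (f - ℓ * g), ?_, ?_⟩
      · refine IsHomogeneous.add ?_ ((hf.sub hg').C_mul c)
        simpa [add_comm] using hx.mul hg
      · rw [pow_succ']
        convert Ideal.mul_mem_mul hc hfg using 1
        ring
    | add x _ y _ hx hy =>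
      obtain ⟨g, hg, hg'⟩ := hx
      obtain ⟨k, hk, hk'⟩ := hy
      refine ⟨g + k, hg.add hk, ?_⟩
      convert Ideal.add_mem _ hg' hk' using 1
      ring

lemma exists_linearForm_pointIdeal {F : Type*} [Field F] {n : ℕ}
    (p : Projectivization F (Fin (n + 1) → F)) :
    ∃ ℓ : MvPolynomial (Fin (n + 1)) F, ℓ.IsHomogeneous 1 ∧
      ∀ x : MvPolynomial (Fin (n + 1)) F, x.IsHomogeneous 1 →
        ∃ c : F, x - C c * ℓ ∈ pointIdeal p := by
  classical
  obtain ⟨j, hj⟩ : ∃ j, p.rep j ≠ 0 := Function.ne_iff.mp p.rep_nonzero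
  refine ⟨X j, isHomogeneous_X _ _, fun x hx => ?_⟩
  rw [← mem_homogeneousSubmodule, homogeneousSubmodule_one_eq_span_X] at hx
  induction hx using Submodule.span_induction with
  | mem x hx =>
    obtain ⟨i, rfl⟩ := hx
    refine ⟨p.rep i / p.rep j, Ideal.subset_span
      ⟨Pi.single i 1 - Pi.single j (p.rep i / p.rep j), ?_, ?_⟩⟩
    · simp [sub_mul, Finset.sum_sub_distrib, Pi.single_apply, hj]
    · simp [sub_mul, Finset.sum_sub_distrib, Pi.single_apply, apply_ite C]
  | zero => exact ⟨0, by simp⟩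
  | add x y _ _ hx hy =>
    obtain ⟨a, ha⟩ := hx
    obtain ⟨b, hb⟩ := hy
    refine ⟨a + b, ?_⟩
    convert Ideal.add_mem _ ha hb using 1
    rw [C_add]
    ring
  | smul c x _ hx =>
    obtain ⟨a, ha⟩ := hx
    refine ⟨c * a, ?_⟩
    convert Ideal.mul_mem_left _ (C c) ha using 1
    rw [C_mul, smul_eq_C_mul]
    ring

/-- A fat point of multiplicity `k + 1` imposes at most `C(n + k, n)` conditions in degree at
least `k`. -/
lemma hilbDim_pointIdeal_pow_le {F : Type*} [Field F] {n : ℕ}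
    (p : Projectivization F (Fin (n + 1) → F)) {k d : ℕ} (hd : k ≤ d) :
    hilbDim (pointIdeal p ^ (k + 1)) d ≤ (n + k).choose n := by
  induction d, hd using Nat.le_induction with
  | base =>
    rw [← finrank_homogeneousSubmodule_fin (F := F)]
    exact Submodule.finrank_map_le _ _
  | succ d hd ih =>
    refine le_trans ?_ ih
    obtain ⟨ℓ, hℓ, hp⟩ := exists_linearForm_pointIdeal p
    set π := Ideal.Quotient.mkₐ F (pointIdeal p ^ (k + 1)) with hπ
    refine le_trans (Submodule.finrank_mono ?_) (Submodule.finrank_map_le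
      (LinearMap.mulLeft F (π ℓ)) ((homogeneousSubmodule (Fin (n + 1)) F d).map π.toLinearMap))
    rintro _ ⟨f, hf, rfl⟩
    obtain ⟨g, hg, hfg⟩ := exists_sub_mul_mem_pow hℓ hp d f hf
    refine ⟨π g, ⟨g, hg, rfl⟩, ?_⟩
    have := Ideal.Quotient.eq.mpr (Ideal.pow_le_pow_right (by omega : k + 1 ≤ d + 1) hfg)
    simpa [hπ] using this.symm

lemma hilbDim_pointIdeal_pow_lt {F : Type*} [Field F] {n : ℕ} (hn : 1 ≤ n)
    (p : Projectivization F (Fin (n + 1) → F)) {k d : ℕ} (hd : d < k) :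
    hilbDim (pointIdeal p ^ (k + 1)) d < (n + k).choose n := by
  refine lt_of_le_of_lt (Submodule.finrank_map_le _ _) ?_
  rw [finrank_homogeneousSubmodule_fin]
  obtain ⟨r, rfl⟩ := Nat.exists_eq_succ_of_ne_zero (by omega : n ≠ 0)
  calc (r + 1 + d).choose (r + 1) < (r + 1 + d + 1).choose (r + 1) := by
        rw [Nat.choose_succ_succ (r + 1 + d)]
        exact Nat.lt_add_of_pos_left (Nat.choose_pos (by omega))
    _ ≤ (r + 1 + k).choose (r + 1) := Nat.choose_le_choose _ (by omega)

/-- Forms of degree `d` impose independent conditions on a fat point scheme for which `hilbDim`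
attains the expected degree: residues at the points can be prescribed simultaneously. -/
lemma exists_forall_sub_mem_of_expDeg_le_hilbDim {F : Type*} [Field F] {n s : ℕ} (hn : 1 ≤ n)
    (p : Fin s → Projectivization F (Fin (n + 1) → F)) (μ : Fin s → ℕ) (hμ : ∀ i, 1 ≤ μ i)
    {d : ℕ} (h : expDeg n μ ≤ hilbDim (fatIdeal p μ) d) :
    (∀ i, μ i ≤ d + 1) ∧
      ∀ v : Fin s → homogeneousSubmodule (Fin (n + 1)) F d,
        ∃ x : homogeneousSubmodule (Fin (n + 1)) F d,
          ∀ i, (x : MvPolynomial (Fin (n + 1)) F) - v i ∈ pointIdeal (p i) ^ μ i := by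
  set H := homogeneousSubmodule (Fin (n + 1)) F d
  let T (I : Ideal (MvPolynomial (Fin (n + 1)) F)) : H →ₗ[F] MvPolynomial (Fin (n + 1)) F ⧸ I :=
    (Ideal.Quotient.mkₐ F I).toLinearMap ∘ₗ H.subtype
  have hT (I : Ideal (MvPolynomial (Fin (n + 1)) F)) :
      finrank F (LinearMap.range (T I)) = hilbDim I d := by
    rw [hilbDim, LinearMap.range_comp, Submodule.range_subtype]
  have hTmem (I : Ideal (MvPolynomial (Fin (n + 1)) F)) (x y : H) :
      T I x = T I y ↔ (x : MvPolynomial (Fin (n + 1)) F) - y ∈ I := Ideal.Quotient.eq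
  have hle : hilbDim (fatIdeal p μ) d ≤
      finrank F (LinearMap.range (LinearMap.pi fun i => T (pointIdeal (p i) ^ μ i))) := by
    rw [← hT]
    refine finrank_range_le_of_ker_le _ _ fun x hx => ?_
    rw [LinearMap.mem_ker, ← map_zero (T _), hTmem, fatIdeal, Ideal.mem_iInf]
    intro i
    rw [← hTmem, map_zero]
    exact congrFun hx i
  have hbound (i : Fin s) :
      hilbDim (pointIdeal (p i) ^ μ i) d ≤ (n + μ i - 1).choose n ∧
      (d + 1 < μ i → hilbDim (pointIdeal (p i) ^ μ i) d < (n + μ i - 1).choose n) := by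
    obtain ⟨k, hk⟩ := Nat.exists_eq_add_of_le' (hμ i)
    rw [hk, show n + (k + 1) - 1 = n + k by omega]
    refine ⟨?_, fun hd => hilbDim_pointIdeal_pow_lt hn _ (by omega)⟩
    rcases le_or_gt k d with hd | hd
    · exact hilbDim_pointIdeal_pow_le _ hd
    · exact (hilbDim_pointIdeal_pow_lt hn _ hd).le
  have hsurj := exists_forall_eq_of_sum_finrank_range_le
    (fun i => T (pointIdeal (p i) ^ μ i)) (by
      simp only [hT]
      exact (Finset.sum_le_sum fun i _ => (hbound i).1).trans (h.trans hle))
  refine ⟨fun i => ?_, fun v => ?_⟩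
  · by_contra! hi
    have hlt : ∑ i, hilbDim (pointIdeal (p i) ^ μ i) d < expDeg n μ :=
      Finset.sum_lt_sum (fun i _ => (hbound i).1) ⟨i, Finset.mem_univ _, (hbound i).2 hi⟩
    refine (hlt.trans_le (h.trans hle)).not_ge ?_
    simp only [← hT]
    exact finrank_range_pi_le _
  · obtain ⟨x, hx⟩ := hsurj v
    exact ⟨x, fun i => (hTmem _ _ _).mp (hx i)⟩

lemma pi_apply_eq_sum_smul_single {F M ι : Type*} [Semiring F] [AddCommMonoid M] [Module F M]
    [Fintype ι] [DecidableEq ι] (f : (ι → F) →ₗ[F] M) (v : ι → F) :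
    f v = ∑ i, v i • f (Pi.single i 1) := by
  convert LinearMap.pi_apply_eq_sum_univ f v using 4
  ext
  simp [Pi.single_apply, eq_comm]

/-- The pullback of forms on `ℙⁿ` to binary forms along the rational curve obtained from the
degree-`m` Veronese map by the linear map `g`. -/
noncomputable def rncPullback {F : Type*} [Field F] {n m : ℕ}
    (g : (Fin (m + 1) → F) →ₗ[F] (Fin (n + 1) → F)) :
    MvPolynomial (Fin (n + 1)) F →ₐ[F] MvPolynomial (Fin 2) F :=
  aeval fun i => ∑ j : Fin (m + 1), C (g (Pi.single j 1) i) * (X 0 ^ (m - (j : ℕ)) * X 1 ^ (j : ℕ))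

lemma isHomogeneous_rncPullback {F : Type*} [Field F] {n m : ℕ}
    (g : (Fin (m + 1) → F) →ₗ[F] (Fin (n + 1) → F)) {f : MvPolynomial (Fin (n + 1)) F} {d : ℕ}
    (hf : f.IsHomogeneous d) : (rncPullback g f).IsHomogeneous (m * d) := by
  refine hf.aeval _ fun i => IsHomogeneous.sum _ _ _ fun j _ => IsHomogeneous.C_mul ?_ _
  have := (isHomogeneous_X_pow (R := F) (0 : Fin 2) (m - (j : ℕ))).mul
    (isHomogeneous_X_pow (1 : Fin 2) (j : ℕ))
  rwa [Nat.sub_add_cancel (Nat.lt_succ_iff.mp j.2)] at this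

lemma exists_rncPullback_eq_monomial {F : Type*} [Field F] {n m : ℕ}
    {g : (Fin (m + 1) → F) →ₗ[F] (Fin (n + 1) → F)} (hg : Function.Injective g)
    (j : Fin (m + 1)) :
    ∃ L : MvPolynomial (Fin (n + 1)) F, L.IsHomogeneous 1 ∧
      rncPullback g L = X 0 ^ (m - (j : ℕ)) * X 1 ^ (j : ℕ) := by
  obtain ⟨h, hh⟩ := g.exists_leftInverse_of_injective (LinearMap.ker_eq_bot.mpr hg)
  refine ⟨∑ i, C (h (Pi.single i 1) j) * X i,
    IsHomogeneous.sum _ _ _ fun i _ => isHomogeneous_C_mul_X _ _, ?_⟩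
  have key (k : Fin (m + 1)) :
      ∑ i, h (Pi.single i 1) j * g (Pi.single k 1) i = if j = k then 1 else 0 := by
    have h₁ := congrFun (LinearMap.congr_fun hh (Pi.single k 1)) j
    rw [LinearMap.comp_apply, pi_apply_eq_sum_smul_single h] at h₁
    simpa [mul_comm, Pi.single_apply k] using h₁
  simp only [rncPullback, map_sum, map_mul, aeval_X, algHom_C, algebraMap_eq, Finset.mul_sum,
    ← mul_assoc]
  rw [Finset.sum_comm]
  simp only [← Finset.sum_mul, ← C_mul, ← map_sum, key]
  simp [apply_ite C]

/-- Evaluating the pullback of a form at a parametrized point of `ℙ¹` whose value at `0` is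
`[s : t]` sends the ideal of the image of `[s : t]` into the ideal of `0`. -/
lemma X_dvd_aeval_rncPullback {F : Type*} [Field F] {n m : ℕ}
    {g : (Fin (m + 1) → F) →ₗ[F] (Fin (n + 1) → F)} {s t : F}
    (h : g (fun j => s ^ (m - (j : ℕ)) * t ^ (j : ℕ)) ≠ 0) {a b : Polynomial F} {r : F}
    (ha : a.coeff 0 = r * s) (hb : b.coeff 0 = r * t) {f : MvPolynomial (Fin (n + 1)) F}
    (hf : f ∈ pointIdeal
      (Projectivization.mk F (g (fun j => s ^ (m - (j : ℕ)) * t ^ (j : ℕ))) h)) :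
    Polynomial.X ∣ aeval ![a, b] (rncPullback g f) := by
  set v : Fin (m + 1) → F := fun j => s ^ (m - (j : ℕ)) * t ^ (j : ℕ) with hv
  rw [← Ideal.mem_span_singleton, ← AlgHom.comp_apply, ← Ideal.mem_comap]
  refine (Ideal.span_le.mpr ?_ : pointIdeal _ ≤ _) hf
  rintro _ ⟨c, hc, rfl⟩
  obtain ⟨u, hu⟩ := Projectivization.exists_smul_eq_mk_rep F (g v) h
  have hcv : ∑ i, c i * g v i = 0 := by
    have : (u : F) * ∑ i, c i * g v i = 0 := by
      rw [← hc, ← hu, Finset.mul_sum]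
      refine Finset.sum_congr rfl fun i _ => ?_
      simp only [Units.smul_def, Pi.smul_apply, smul_eq_mul]
      ring
    exact (mul_eq_zero.mp this).resolve_left u.ne_zero
  rw [SetLike.mem_coe, Ideal.mem_comap, Ideal.mem_span_singleton, Polynomial.X_dvd_iff,
    Polynomial.coeff_zero_eq_eval_zero]
  rw [Polynomial.coeff_zero_eq_eval_zero] at ha hb
  have hgv (i : Fin (n + 1)) :
      ∑ j : Fin (m + 1), g (Pi.single j 1) i * ((r * s) ^ (m - (j : ℕ)) * (r * t) ^ (j : ℕ)) =
        r ^ m * g v i := by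
    rw [pi_apply_eq_sum_smul_single g v, Finset.sum_apply, Finset.mul_sum]
    refine Finset.sum_congr rfl fun j _ => ?_
    have hr : r ^ m = r ^ (m - (j : ℕ)) * r ^ (j : ℕ) := by
      rw [← pow_add, Nat.sub_add_cancel (Nat.lt_succ_iff.mp j.2)]
    rw [hr, hv]
    simp only [Pi.smul_apply, smul_eq_mul]
    ring
  have : ∑ i, c i * (r ^ m * g v i) = 0 := by
    simp only [mul_left_comm (c _), ← Finset.mul_sum, hcv, mul_zero]
  simpa [rncPullback, Polynomial.eval_finsetSum, ha, hb, hgv] using this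

/-- Near each point of a rational normal curve of positive degree there is a parametrization
of the curve along which linear forms restrict to the local parameter and to `1`. -/
lemma exists_local_parametrization {F : Type*} [Field F] {n m : ℕ} (hm : 1 ≤ m)
    {g : (Fin (m + 1) → F) →ₗ[F] (Fin (n + 1) → F)} (hg : Function.Injective g) {s t : F}
    (hst : s ≠ 0 ∨ t ≠ 0) (h : g (fun j => s ^ (m - (j : ℕ)) * t ^ (j : ℕ)) ≠ 0) :
    ∃ ρ : MvPolynomial (Fin 2) F →ₐ[F] Polynomial F,
      (∀ f ∈ pointIdeal
        (Projectivization.mk F (g (fun j => s ^ (m - (j : ℕ)) * t ^ (j : ℕ))) h),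
          Polynomial.X ∣ ρ (rncPullback g f)) ∧
      (∃ L : MvPolynomial (Fin (n + 1)) F, L.IsHomogeneous 1 ∧
        ρ (rncPullback g L) = Polynomial.X) ∧
      ∃ M : MvPolynomial (Fin (n + 1)) F, M.IsHomogeneous 1 ∧ ρ (rncPullback g M) = 1 := by
  obtain ⟨k, rfl⟩ := Nat.exists_eq_add_of_le' hm
  rcases hst with hs | ht
  · obtain ⟨M, hM, hM'⟩ := exists_rncPullback_eq_monomial hg 0
    obtain ⟨L, hL, hL'⟩ := exists_rncPullback_eq_monomial hg 1
    refine ⟨aeval ![1, Polynomial.X + Polynomial.C (s⁻¹ * t)], fun f hf =>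
      X_dvd_aeval_rncPullback (r := s⁻¹) h (by simp [hs]) (by simp) hf,
      ⟨L - C (s⁻¹ * t) * M, hL.sub (hM.C_mul _), ?_⟩, M, hM, ?_⟩
    · simp [hL', hM', algHom_C]
    · simp [hM']
  · obtain ⟨M, hM, hM'⟩ := exists_rncPullback_eq_monomial hg (Fin.last (k + 1))
    obtain ⟨L, hL, hL'⟩ := exists_rncPullback_eq_monomial hg (Fin.last k).castSucc
    refine ⟨aeval ![Polynomial.X + Polynomial.C (t⁻¹ * s), 1], fun f hf =>
      X_dvd_aeval_rncPullback (r := t⁻¹) h (by simp) (by simp [ht]) hf,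
      ⟨L - C (t⁻¹ * s) * M, hL.sub (hM.C_mul _), ?_⟩, M, hM, ?_⟩
    · simp [hL', hM', algHom_C]
    · simp [hM']

/-- **Remark `ss12`** (a necessary condition).  If `C ⊂ ℙⁿ` is a rational normal curve of
degree `m` (`1 ≤ m ≤ n`) and `Z = Σ m_i p_i` is a fat point scheme on distinct points with
`w_C(Z) ≥ md + 2`, then `h¹(I_Z(d)) > 0`. -/
theorem h1_pos_of_rnc_weight {K : Type*} [Field K] [IsAlgClosed K] {n s : ℕ}
    (hn : 1 ≤ n)
    (p : Fin s → Projectivization K (Fin (n + 1) → K)) (hinj : Function.Injective p)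
    (mults : Fin s → ℕ) (hm : ∀ i, 1 ≤ mults i)
    {m : ℕ} (hm1 : 1 ≤ m) (hmn : m ≤ n)
    (C : Set (Projectivization K (Fin (n + 1) → K))) (hC : IsRNC n m C)
    (d : ℕ) (hw : m * d + 2 ≤ weightIn p mults C) :
    hilbDim (fatIdeal p mults) d < expDeg n mults := by
  classical
  by_contra! hcon
  obtain ⟨hle, hsurj⟩ := exists_forall_sub_mem_of_expDeg_le_hilbDim hn p mults hm hcon
  obtain ⟨g, hg, rfl⟩ := hC
  set C := {x | ∃ s t : K, (s ≠ 0 ∨ t ≠ 0) ∧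
      ∃ h : g (fun j => s ^ (m - (j : ℕ)) * t ^ (j : ℕ)) ≠ 0,
        x = Projectivization.mk K (g (fun j => s ^ (m - (j : ℕ)) * t ^ (j : ℕ))) h}
  have hloc : ∀ i : {i // p i ∈ C}, ∃ ρ : MvPolynomial (Fin 2) K →ₐ[K] Polynomial K,
      (∀ f ∈ pointIdeal (p i), Polynomial.X ∣ ρ (rncPullback g f)) ∧
      (∃ L : MvPolynomial (Fin (n + 1)) K, L.IsHomogeneous 1 ∧
        ρ (rncPullback g L) = Polynomial.X) ∧
      ∃ M : MvPolynomial (Fin (n + 1)) K, M.IsHomogeneous 1 ∧ ρ (rncPullback g M) = 1 := by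
    rintro ⟨i, a, b, hab, h, hi⟩
    simp only [hi]
    exact exists_local_parametrization hm1 hg hab h
  choose ρ hρ hL hM using hloc
  choose L hL hL' using hL
  choose M hM hM' using hM
  let Θ : MvPolynomial (Fin 2) K →ₗ[K] ((Σ i : {i // p i ∈ C}, Fin (mults i)) → K) :=
    LinearMap.pi fun x => Polynomial.lcoeff K x.2 ∘ₗ (ρ x.1).toLinearMap
  have hΘ : (homogeneousSubmodule (Fin 2) K (m * d)).map Θ = ⊤ := by
    refine eq_top_iff.mpr fun y _ => ?_
    have hexp (i : {i // p i ∈ C}) (k : Fin (mults i)) : (k : ℕ) ≤ d := by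
      have := hle i
      omega
    let w (i : {i // p i ∈ C}) : homogeneousSubmodule (Fin (n + 1)) K d :=
      ⟨∑ k : Fin (mults i), MvPolynomial.C (y ⟨i, k⟩) * (L i ^ (k : ℕ) * M i ^ (d - (k : ℕ))),
        IsHomogeneous.sum _ _ _ fun k _ => IsHomogeneous.C_mul (by
          have := ((hL i).pow (k : ℕ)).mul ((hM i).pow (d - (k : ℕ)))
          rwa [one_mul, one_mul, Nat.add_sub_cancel' (hexp i k)] at this) _⟩
    have hwi (i : {i // p i ∈ C}) : ρ i (rncPullback g (w i)) =
        ∑ k : Fin (mults i), Polynomial.C (y ⟨i, k⟩) * Polynomial.X ^ (k : ℕ) := by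
      simp [w, hL', hM', algHom_C]
    obtain ⟨x, hx⟩ := hsurj fun i => if hi : p i ∈ C then w ⟨i, hi⟩ else 0
    refine ⟨rncPullback g x, isHomogeneous_rncPullback g x.2, ?_⟩
    ext ⟨i, k⟩
    have hdvd : Polynomial.X ^ mults i ∣ ρ i (rncPullback g (x - w i)) := by
      have hxi := hx i
      rw [dif_pos i.2] at hxi
      have hcomap : pointIdeal (p i) ≤
          (Ideal.span {Polynomial.X}).comap ((ρ i).comp (rncPullback g)) :=
        fun f hf => Ideal.mem_span_singleton.mpr (hρ i f hf)
      rw [← Ideal.mem_span_singleton, ← Ideal.span_singleton_pow]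
      exact Ideal.le_comap_pow ((ρ i).comp (rncPullback g)) _ (Ideal.pow_right_mono hcomap _ hxi)
    have hcoeff := Polynomial.X_pow_dvd_iff.mp hdvd k k.2
    rw [map_sub, map_sub, Polynomial.coeff_sub, sub_eq_zero, hwi] at hcoeff
    simpa [Θ, Polynomial.coeff_X_pow, Fin.val_inj] using hcoeff
  have hcard : weightIn p mults C ≤ m * d + 1 := by
    calc weightIn p mults C = finrank K ((Σ i : {i // p i ∈ C}, Fin (mults i)) → K) := by
          rw [Module.finrank_fintype_fun_eq_card, Fintype.card_sigma, weightIn,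
            ← Finset.sum_filter,
            Finset.sum_subtype (p := fun i => p i ∈ C) (F := Subtype.fintype _) _ (by simp)]
          simp
      _ = finrank K ((homogeneousSubmodule (Fin 2) K (m * d)).map Θ) := by
          rw [hΘ, finrank_top]
      _ ≤ finrank K (homogeneousSubmodule (Fin 2) K (m * d)) := Submodule.finrank_map_le _ _
      _ = m * d + 1 := by
          rw [finrank_homogeneousSubmodule_fin 1, Nat.choose_one_right, add_comm]
  omega
end
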